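/- Assume the compound Poisson setup (with f additionally convex and nondecreasing), the definition of g, and the scale assumptions of the context, and assume x = ‖x‖·e₁. With z := x/ε, for m ≥ 2 the single-jump density of the bridge with exactly m jumps is ῡ_z^{m,1}(w) := p_m(z)⁻¹·exp(−f(‖w‖))·p_{m−1}(z − w), and for m = 1 the single jump equals z; let W_ε be the probability measure on ℝⁿ defined by W_ε(A) := q_ε(1)·δ_z(A) + Σ_{m=2}^∞ q_ε(m)·∫_A ῡ_z^{m,1}(w) dw, where q_ε(m) := e^{−r_εT}·((r_εT)ᵐ/m!)·p_m(z)/μ_{r_εT}(z). Set c_ε := g(‖x‖/(ε·r_ε·T)). Then for all δ ∈ (0,1) and K > 0 there exists ε₀ > 0 such that for all 0 < ε < ε₀ and every Borel set A ⊆ {y ∈ ℝⁿ : ‖y − c_ε·e₁‖ ≤ K·f″(c_ε)^{−1/2}}: W_ε(A) ≥ (1−δ)·∫_A (f″(c_ε)/(2π))^{n/2}·(α−1)^{−(n−1)/2}·exp( −(f″(c_ε)/2)·( (y₁ − c_ε)² + (α−1)⁻¹·Σ_{i=2}^{n} y_i² ) ) dy; i.e. on this ball the jump law dominates (1−δ)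 times the Gaussian law with mean c_ε·e₁ and covariance f″(c_ε)⁻¹·diag(1, α−1, …, α−1). -/

import Mathlib

open MeasureTheory Filter Real Set
open scoped Topology BigOperators ENNReal RealInnerProductSpace

noncomputable section

/-- `f` is smoothly regularly varying of index `α`: beyond some `z₀ ≥ 1` it is positive and
infinitely differentiable, and `h u = log (f (exp u))` satisfies `h' → α` and
`h^(m) → 0` for every `m ≥ 2`. -/
def SmoothRegVary (α : ℝ) (f : ℝ → ℝ) : Prop :=
  ∃ z₀ : ℝ, 1 ≤ z₀ ∧ (∀ x, z₀ < x → 0 < f x) ∧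
    ContDiffOn ℝ (⊤ : ℕ∞) f (Set.Ioi z₀) ∧
    Filter.Tendsto (deriv (fun u => Real.log (f (Real.exp u)))) Filter.atTop (nhds α) ∧
    ∀ m : ℕ, 2 ≤ m →
      Filter.Tendsto (iteratedDeriv m (fun u => Real.log (f (Real.exp u))))
        Filter.atTop (nhds 0)

/-- `convPow n p m` is the `(m+1)`-fold convolution power of the density `p` on `ℝⁿ`;
so `convPow n p 0 = p` and `convPow n p (m+1) = (convPow n p m) ⋆ p`. -/
def convPow (n : ℕ) (p : EuclideanSpace ℝ (Fin n) → ℝ) : ℕ → EuclideanSpace ℝ (Fin n) → ℝ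
  | 0 => p
  | m + 1 => fun x => ∫ y, convPow n p m (x - y) * p y

/-- `cpDensity n f t x = Σ_{m≥1} e^{-t} tᵐ/m! · p_m(x)`, the density (away from 0) of the
time-`t` marginal of the compound Poisson process with jump density `exp (-f ‖z‖)`. -/
def cpDensity (n : ℕ) (f : ℝ → ℝ) (t : ℝ) (x : EuclideanSpace ℝ (Fin n)) : ℝ :=
  ∑' m : ℕ, Real.exp (-t) * t ^ (m + 1) / (Nat.factorial (m + 1) : ℝ) *
    convPow n (fun z => Real.exp (-f ‖z‖)) m x
/-- The conditional probability that the compound Poisson process with jump density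
`exp (-f‖·‖)` makes exactly `m ≥ 1` jumps on `[0,τ]` given time-`τ` marginal `z`. -/
def jumpCountProb (n : ℕ) (f : ℝ → ℝ) (τ : ℝ) (z : EuclideanSpace ℝ (Fin n)) (m : ℕ) : ℝ :=
  Real.exp (-τ) * τ ^ m / (Nat.factorial m : ℝ) *
    convPow n (fun w => Real.exp (-f ‖w‖)) (m - 1) z / cpDensity n f τ z

/-- For `m ≥ 2`, the density of a single jump of the bridge from `0` to `z` with exactly
`m` jumps: `ῡ_z^{m,1}(w) = p_m(z)⁻¹ exp(-f‖w‖) p_{m-1}(z-w)`. -/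
def singleJumpDensity (n : ℕ) (f : ℝ → ℝ) (z : EuclideanSpace ℝ (Fin n)) (m : ℕ)
    (w : EuclideanSpace ℝ (Fin n)) : ℝ :=
  (convPow n (fun v => Real.exp (-f ‖v‖)) (m - 1) z)⁻¹ * Real.exp (-f ‖w‖) *
    convPow n (fun v => Real.exp (-f ‖v‖)) (m - 2) (z - w)

/-- The law `W_ε` of a single jump of the bridge from `0` to `z`: with one jump the single
jump equals `z`; with `m ≥ 2` jumps it has density `ῡ_z^{m,1}`. -/
def singleJumpLaw (n : ℕ) (f : ℝ → ℝ) (τ : ℝ) (z : EuclideanSpace ℝ (Fin n))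
    (A : Set (EuclideanSpace ℝ (Fin n))) : ℝ :=
  jumpCountProb n f τ z 1 * Set.indicator A (fun _ => (1 : ℝ)) z +
    ∑' m : ℕ, jumpCountProb n f τ z (m + 2) * ∫ w in A, singleJumpDensity n f z (m + 2) w

/-- Log-concavity for extended nonnegative functions, zeros and infinite values allowed. -/
def LogConcaveENN {V : Type*} [AddCommGroup V] [Module ℝ V] (F : V → ℝ≥0∞) : Prop :=
  ∀ x y : V, ∀ a b : ℝ, 0 < a → 0 < b → a + b = 1 → F x ^ a * F y ^ b ≤ F (a • x + b • y)

lemma LogConcaveENN.convex_superlevel {V : Type*} [AddCommGroup V] [Module ℝ V] {F : V → ℝ≥0∞}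
    (hF : LogConcaveENN F) {t : ℝ≥0∞} (ht : t ≠ ∞) : Convex ℝ {x | t < F x} := by
  rw [convex_iff_forall_pos]
  intro x hx y hy a b ha hb hab
  refine lt_of_lt_of_le ?_ (hF x y a b ha hb hab)
  rcases eq_or_ne t 0 with rfl | ht0
  · simp only [mem_ofPred_eq] at hx hy
    exact ENNReal.mul_pos (by simp [hx.ne', ENNReal.rpow_eq_zero_iff, ha.not_gt])
      (by simp [hy.ne', ENNReal.rpow_eq_zero_iff, hb.not_gt])
  · calc t = t ^ a * t ^ b := by rw [← ENNReal.rpow_add _ _ ht0 ht, hab, ENNReal.rpow_one]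
      _ < F x ^ a * F y ^ b :=
        ENNReal.mul_lt_mul (ENNReal.rpow_lt_rpow hx ha) (ENNReal.rpow_lt_rpow hy hb)

/-- One-dimensional Brunn–Minkowski inequality, with values in a convex set. -/
lemma Real.mul_ediam_add_le_volume {S T U : Set ℝ} (hS : S.Nonempty) (hT : T.Nonempty)
    (hU : Convex ℝ U) {a b : ℝ} (ha : 0 < a) (hb : 0 < b)
    (h : ∀ x ∈ S, ∀ y ∈ T, a * x + b * y ∈ U) :
    ENNReal.ofReal a * Metric.ediam S + ENNReal.ofReal b * Metric.ediam T ≤ volume U := by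
  have hd : ∀ S : Set ℝ, Metric.ediam S = ⨆ p : S × S, edist (p.1 : ℝ) p.2 := by
    intro S
    rw [Metric.ediam, iSup_prod]
    simp only [iSup_subtype]
  have key : ∀ x ∈ S, ∀ x' ∈ S, ∀ y ∈ T, ∀ y' ∈ T, x ≤ x' → y ≤ y' →
      ENNReal.ofReal a * edist x x' + ENNReal.ofReal b * edist y y' ≤ volume U := by
    intro x hx x' hx' y hy y' hy' hxx hyy
    have hsub : Icc (a * x + b * y) (a * x' + b * y') ⊆ U :=
      hU.ordConnected.out (h x hx y hy) (h x' hx' y' hy')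
    refine le_trans (le_of_eq ?_) (measure_mono hsub)
    rw [Real.volume_Icc, edist_comm x, edist_comm y, edist_dist, edist_dist, Real.dist_eq,
      Real.dist_eq, abs_of_nonneg (sub_nonneg.2 hxx), abs_of_nonneg (sub_nonneg.2 hyy),
      ← ENNReal.ofReal_mul ha.le, ← ENNReal.ofReal_mul hb.le, ← ENNReal.ofReal_add]
    · congr 1; ring
    · exact mul_nonneg ha.le (sub_nonneg.2 hxx)
    · exact mul_nonneg hb.le (sub_nonneg.2 hyy)
  rw [hd S, hd T, ENNReal.mul_iSup, ENNReal.mul_iSup]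
  have : Nonempty S := hS.to_subtype
  have : Nonempty T := hT.to_subtype
  refine ENNReal.iSup_add_iSup_le ?_
  rintro ⟨⟨x, hx⟩, ⟨x', hx'⟩⟩ ⟨⟨y, hy⟩, ⟨y', hy'⟩⟩
  rcases le_total x x' with h1 | h1 <;> rcases le_total y y' with h2 | h2
  · exact key x hx x' hx' y hy y' hy' h1 h2
  · simpa only [edist_comm] using key x hx x' hx' y' hy' y hy h1 h2
  · simpa only [edist_comm] using key x' hx' x hx y hy y' hy' h1 h2
  · simpa only [edist_comm] using key x' hx' x hx y' hy' y hy h1 h2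

lemma lintegral_min_one_eq_lintegral_meas_lt {h : ℝ → ℝ≥0∞} (hm : Measurable h) :
    ∫⁻ x, min (h x) 1 = ∫⁻ t in Ioo (0 : ℝ) 1, volume {x | ENNReal.ofReal t < h x} := by
  have hfin : ∀ x, min (h x) 1 ≠ ∞ := fun x => ne_top_of_le_ne_top ENNReal.one_ne_top (min_le_right _ _)
  have h1 : ∫⁻ x, min (h x) 1 = ∫⁻ x, ENNReal.ofReal ((min (h x) 1).toReal) := by
    refine lintegral_congr fun x => ?_
    rw [ENNReal.ofReal_toReal (hfin x)]
  rw [h1, lintegral_eq_lintegral_meas_lt volume (Eventually.of_forall fun x => ENNReal.toReal_nonneg)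
    (by fun_prop)]
  rw [← lintegral_indicator measurableSet_Ioi, ← lintegral_indicator measurableSet_Ioo]
  refine lintegral_congr fun t => ?_
  by_cases h0 : 0 < t
  · rw [indicator_of_mem (show t ∈ Ioi (0:ℝ) from h0)]
    by_cases h2 : t < 1
    · rw [indicator_of_mem (show t ∈ Ioo (0:ℝ) 1 from ⟨h0, h2⟩)]
      congr 1
      ext x
      simp only [mem_ofPred_eq]
      rw [← ENNReal.ofReal_lt_iff_lt_toReal h0.le (hfin x), lt_min_iff]
      simp [h2]
    · rw [indicator_of_notMem (show t ∉ Ioo (0:ℝ) 1 from fun h => h2 h.2)]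
      convert measure_empty (μ := (volume : Measure ℝ))
      ext x
      simp only [mem_ofPred_eq, mem_empty_iff_false, iff_false, not_lt]
      refine le_trans ?_ (not_lt.1 h2)
      have := ENNReal.toReal_mono ENNReal.one_ne_top (min_le_right (h x) 1)
      simpa using this
  · rw [indicator_of_notMem (show t ∉ Ioi (0:ℝ) from h0),
      indicator_of_notMem (show t ∉ Ioo (0:ℝ) 1 from fun h => h0 h.1)]

lemma prekopa_leindler_aux {f g h : ℝ → ℝ≥0∞} (hfm : Measurable f) (hgm : Measurable g)
    (hhm : Measurable h) (hh : LogConcaveENN h)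
    (hf1 : ⨆ x, f x = 1) (hg1 : ⨆ x, g x = 1) {a b : ℝ} (ha : 0 < a) (hb : 0 < b)
    (hab : a + b = 1) (H : ∀ x y, f x ^ a * g y ^ b ≤ h (a * x + b * y)) :
    ENNReal.ofReal a * (∫⁻ x, f x) + ENNReal.ofReal b * (∫⁻ x, g x) ≤ ∫⁻ x, h x := by
  have hf : ∀ x, f x = min (f x) 1 := fun x => (min_eq_left (hf1 ▸ le_iSup f x)).symm
  have hg : ∀ x, g x = min (g x) 1 := fun x => (min_eq_left (hg1 ▸ le_iSup g x)).symm
  have anti : ∀ u : ℝ → ℝ≥0∞, Measurable fun t : ℝ => volume {x | ENNReal.ofReal t < u x} := by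
    intro u
    refine Antitone.measurable fun s t hst => measure_mono fun x hx => ?_
    exact lt_of_le_of_lt (ENNReal.ofReal_le_ofReal hst) hx
  rw [lintegral_congr hf, lintegral_congr hg, lintegral_min_one_eq_lintegral_meas_lt hfm,
    lintegral_min_one_eq_lintegral_meas_lt hgm, ← lintegral_const_mul _ (anti f),
    ← lintegral_const_mul _ (anti g), ← lintegral_add_left ((anti f).const_mul _)]
  calc _ ≤ ∫⁻ t in Ioo (0 : ℝ) 1, volume {x | ENNReal.ofReal t < h x} := by
        refine setLIntegral_mono (anti h) fun t ht => ?_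
        have ht1 : ENNReal.ofReal t < 1 := by simpa using ht.2
        have ht0 : ENNReal.ofReal t ≠ 0 := by simpa using ht.1
        obtain ⟨x, hx⟩ := lt_iSup_iff.1 (hf1 ▸ ht1)
        obtain ⟨y, hy⟩ := lt_iSup_iff.1 (hg1 ▸ ht1)
        refine le_trans ?_ (Real.mul_ediam_add_le_volume (S := {x | ENNReal.ofReal t < f x})
          (T := {x | ENNReal.ofReal t < g x}) ⟨x, hx⟩ ⟨y, hy⟩
          (hh.convex_superlevel ENNReal.ofReal_ne_top) ha hb ?_)
        · gcongr <;> exact Real.volume_le_diam _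
        · intro x hx y hy
          refine lt_of_lt_of_le ?_ (H x y)
          calc ENNReal.ofReal t = ENNReal.ofReal t ^ a * ENNReal.ofReal t ^ b := by
                rw [← ENNReal.rpow_add _ _ ht0 ENNReal.ofReal_ne_top, hab, ENNReal.rpow_one]
            _ < _ := ENNReal.mul_lt_mul (ENNReal.rpow_lt_rpow hx ha) (ENNReal.rpow_lt_rpow hy hb)
    _ = ∫⁻ x, min (h x) 1 := (lintegral_min_one_eq_lintegral_meas_lt hhm).symm
    _ ≤ ∫⁻ x, h x := lintegral_mono fun x => min_le_left _ _

lemma ENNReal.rpow_mul_rpow_le_add (u v : ℝ≥0∞) {a b : ℝ} (ha : 0 < a) (hb : 0 < b)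
    (hab : a + b = 1) : u ^ a * v ^ b ≤ ENNReal.ofReal a * u + ENNReal.ofReal b * v := by
  rcases eq_or_ne u ∞ with rfl | hu
  · rw [ENNReal.mul_top (by simpa using ha)]; simp
  rcases eq_or_ne v ∞ with rfl | hv
  · rw [ENNReal.mul_top (by simpa using hb)]; simp
  lift u to NNReal using hu
  lift v to NNReal using hv
  have := NNReal.geom_mean_le_arith_mean2_weighted (⟨a, ha.le⟩ : NNReal) ⟨b, hb.le⟩ u v
    (by ext; exact hab)
  rw [← ENNReal.coe_rpow_of_nonneg _ ha.le, ← ENNReal.coe_rpow_of_nonneg _ hb.le,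
    ENNReal.ofReal_eq_coe_nnreal ha.le, ENNReal.ofReal_eq_coe_nnreal hb.le]
  exact_mod_cast this

lemma prekopa_leindler_of_bounded {f g h : ℝ → ℝ≥0∞} (hfm : Measurable f) (hgm : Measurable g)
    (hhm : Measurable h) (hh : LogConcaveENN h) {k : ℝ≥0∞} (hk : k ≠ ∞)
    (hfk : ∀ x, f x ≤ k) (hgk : ∀ x, g x ≤ k) {a b : ℝ} (ha : 0 < a) (hb : 0 < b)
    (hab : a + b = 1) (H : ∀ x y, f x ^ a * g y ^ b ≤ h (a * x + b * y)) :
    (∫⁻ x, f x) ^ a * (∫⁻ x, g x) ^ b ≤ ∫⁻ x, h x := by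
  set A := ⨆ x, f x with hA
  set B := ⨆ x, g x with hB
  have hAt : A ≠ ∞ := ne_top_of_le_ne_top hk (iSup_le hfk)
  have hBt : B ≠ ∞ := ne_top_of_le_ne_top hk (iSup_le hgk)
  rcases eq_or_ne A 0 with hA0 | hA0
  · have : ∀ x, f x = 0 := fun x => by
      have := le_iSup f x
      rw [← hA, hA0] at this
      exact le_antisymm this (zero_le)
    simp [this, ha]
  rcases eq_or_ne B 0 with hB0 | hB0
  · have : ∀ x, g x = 0 := fun x => by
      have := le_iSup g x
      rw [← hB, hB0] at this
      exact le_antisymm this (zero_le)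
    simp [this, hb]
  set C := A ^ a * B ^ b with hC
  have hC0 : C ≠ 0 := by
    simp [hC, ENNReal.rpow_eq_zero_iff, hA0, hB0, hAt, hBt]
  have hCt : C ≠ ∞ := ENNReal.mul_ne_top (ENNReal.rpow_ne_top_of_nonneg ha.le hAt)
    (ENNReal.rpow_ne_top_of_nonneg hb.le hBt)
  have key := prekopa_leindler_aux (f := fun x => A⁻¹ * f x) (g := fun x => B⁻¹ * g x)
    (h := fun x => C⁻¹ * h x) (hfm.const_mul _) (hgm.const_mul _) (hhm.const_mul _)
    (by
      intro x y a b ha hb hab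
      calc (C⁻¹ * h x) ^ a * (C⁻¹ * h y) ^ b = (C⁻¹ ^ a * C⁻¹ ^ b) * (h x ^ a * h y ^ b) := by
            rw [ENNReal.mul_rpow_of_nonneg _ _ ha.le, ENNReal.mul_rpow_of_nonneg _ _ hb.le]; ring
        _ ≤ C⁻¹ * h (a • x + b • y) := by
            rw [← ENNReal.rpow_add _ _ (by simpa using hCt) (by simpa using hC0), hab,
              ENNReal.rpow_one]
            gcongr
            exact hh x y a b ha hb hab)
    (by rw [← ENNReal.mul_iSup, ← hA, ENNReal.inv_mul_cancel hA0 hAt])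
    (by rw [← ENNReal.mul_iSup, ← hB, ENNReal.inv_mul_cancel hB0 hBt]) ha hb hab
    (by
      intro x y
      rw [ENNReal.mul_rpow_of_nonneg _ _ ha.le, ENNReal.mul_rpow_of_nonneg _ _ hb.le]
      calc _ = (A⁻¹ ^ a * B⁻¹ ^ b) * (f x ^ a * g y ^ b) := by ring
        _ ≤ C⁻¹ * h (a * x + b * y) := by
          rw [hC, ENNReal.mul_inv (Or.inl (by simp [ENNReal.rpow_eq_zero_iff, hA0, hAt]))
            (Or.inl (ENNReal.rpow_ne_top_of_nonneg ha.le hAt)), ← ENNReal.inv_rpow,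
            ← ENNReal.inv_rpow]
          gcongr
          exact H x y)
  rw [lintegral_const_mul _ hfm, lintegral_const_mul _ hgm, lintegral_const_mul _ hhm] at key
  have h2 := (ENNReal.rpow_mul_rpow_le_add (A⁻¹ * ∫⁻ x, f x) (B⁻¹ * ∫⁻ x, g x) ha hb hab).trans key
  rw [ENNReal.mul_rpow_of_nonneg _ _ ha.le, ENNReal.mul_rpow_of_nonneg _ _ hb.le] at h2
  have h3 : C * (C⁻¹ * ∫⁻ x, h x) = ∫⁻ x, h x := by
    rw [← mul_assoc, ENNReal.mul_inv_cancel hC0 hCt, one_mul]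
  rw [← h3]
  refine le_trans (le_of_eq ?_) (mul_le_mul_right h2 C)
  have hA1 : A ^ a * A⁻¹ ^ a = 1 := by
    rw [ENNReal.inv_rpow, ENNReal.mul_inv_cancel (by simp [ENNReal.rpow_eq_zero_iff, hA0, hAt])
      (ENNReal.rpow_ne_top_of_nonneg ha.le hAt)]
  have hB1 : B ^ b * B⁻¹ ^ b = 1 := by
    rw [ENNReal.inv_rpow, ENNReal.mul_inv_cancel (by simp [ENNReal.rpow_eq_zero_iff, hB0, hBt])
      (ENNReal.rpow_ne_top_of_nonneg hb.le hBt)]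
  calc _ = (A ^ a * A⁻¹ ^ a) * (B ^ b * B⁻¹ ^ b) * ((∫⁻ x, f x) ^ a * (∫⁻ x, g x) ^ b) := by
        rw [hA1, hB1]; ring
    _ = _ := by rw [hC]; ring

lemma lintegral_min_nat_tendsto {f : ℝ → ℝ≥0∞} (hfm : Measurable f) :
    Tendsto (fun k : ℕ => ∫⁻ x, min (f x) ((k + 1 : ℕ) : ℝ≥0∞)) atTop (𝓝 (∫⁻ x, f x)) := by
  refine lintegral_tendsto_of_tendsto_of_monotone (fun k => (hfm.min measurable_const).aemeasurable)
    (Eventually.of_forall fun x k l hkl => ?_) (Eventually.of_forall fun x => ?_)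
  · exact min_le_min_left _ (by exact_mod_cast Nat.succ_le_succ hkl)
  · have h1 : Tendsto (fun k : ℕ => ((k + 1 : ℕ) : ℝ≥0∞)) atTop (𝓝 ∞) :=
      ENNReal.tendsto_nat_nhds_top.comp (tendsto_add_atTop_nat 1)
    simpa using (tendsto_const_nhds (x := f x)).min h1

/-- One-dimensional Prékopa–Leindler inequality (with a log-concave majorant). -/
lemma prekopa_leindler_one_dim {f g h : ℝ → ℝ≥0∞} (hfm : Measurable f) (hgm : Measurable g)
    (hhm : Measurable h) (hh : LogConcaveENN h) {a b : ℝ} (ha : 0 < a) (hb : 0 < b)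
    (hab : a + b = 1) (H : ∀ x y, f x ^ a * g y ^ b ≤ h (a * x + b * y)) :
    (∫⁻ x, f x) ^ a * (∫⁻ x, g x) ^ b ≤ ∫⁻ x, h x := by
  rcases eq_or_ne (∫⁻ x, f x) 0 with hf0 | hf0
  · simp [hf0, ha]
  rcases eq_or_ne (∫⁻ x, g x) 0 with hg0 | hg0
  · simp [hg0, hb]
  have T := ENNReal.Tendsto.mul
    (((ENNReal.continuous_rpow_const (y := a)).tendsto _).comp (lintegral_min_nat_tendsto hfm))
    (Or.inl (by simp [ENNReal.rpow_eq_zero_iff, hf0, ha.not_gt]))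
    (((ENNReal.continuous_rpow_const (y := b)).tendsto _).comp (lintegral_min_nat_tendsto hgm))
    (Or.inl (by simp [ENNReal.rpow_eq_zero_iff, hg0, hb.not_gt]))
  refine le_of_tendsto' T fun k => ?_
  refine prekopa_leindler_of_bounded (hfm.min measurable_const) (hgm.min measurable_const) hhm hh
    (ENNReal.natCast_ne_top (k + 1)) (fun x => min_le_right _ _) (fun x => min_le_right _ _)
    ha hb hab fun x y => ?_
  refine le_trans ?_ (H x y)
  gcongr <;> exact min_le_left _ _

/-- Prékopa's theorem: partial integrals over `ℝᵏ` of log-concave functions are log-concave. -/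
theorem LogConcaveENN.lintegral_pi (k : ℕ) : ∀ {V : Type} [AddCommGroup V] [Module ℝ V]
    {F : V × (Fin k → ℝ) → ℝ≥0∞}, LogConcaveENN F → (∀ v, Measurable fun y => F (v, y)) →
    LogConcaveENN fun v => ∫⁻ y, F (v, y) := by
  induction k with
  | zero =>
    intro V _ _ F hF hm x y a b ha hb hab
    have h0 : ∀ v, ∫⁻ y, F (v, y) = F (v, 0) := by
      intro v
      have h1 : ∀ w : Fin 0 → ℝ, F (v, w) = F (v, 0) := fun w => by rw [Subsingleton.elim w 0]
      rw [lintegral_unique, volume_pi, Measure.pi_univ, h1]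
      simp
    simp only [h0]
    simpa using hF (x, 0) (y, 0) a b ha hb hab
  | succ k ih =>
    intro V _ _ F hF hm
    have e := volume_preserving_piFinSuccAbove (fun _ : Fin (k + 1) => ℝ) 0
    have he : ∀ p : ℝ × (Fin k → ℝ),
        (MeasurableEquiv.piFinSuccAbove (fun _ : Fin (k + 1) => ℝ) 0).symm p =
          (Fin.cons p.1 p.2 : Fin (k + 1) → ℝ) := by
      intro p
      exact Fin.insertNth_zero' p.1 p.2
    have hm' : ∀ v, Measurable fun p : ℝ × (Fin k → ℝ) => F (v, (Fin.cons p.1 p.2 : Fin (k+1) → ℝ)) := by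
      intro v
      simp only [← he]
      exact (hm v).comp (MeasurableEquiv.piFinSuccAbove (fun _ : Fin (k + 1) => ℝ) 0).symm.measurable
    have hInt : ∀ v, ∫⁻ y, F (v, y) = ∫⁻ t : ℝ, ∫⁻ y : Fin k → ℝ, F (v, (Fin.cons t y : Fin (k+1) → ℝ)) := by
      intro v
      rw [← e.symm.lintegral_comp (hm v)]
      rw [Measure.volume_eq_prod, lintegral_prod _ (Measurable.aemeasurable ?_)]
      · simp only [he]
      · exact (hm v).comp (MeasurableEquiv.piFinSuccAbove (fun _ : Fin (k + 1) => ℝ) 0).symm.measurable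
    have hG : LogConcaveENN (fun q : V × ℝ => ∫⁻ y : Fin k → ℝ, F (q.1, (Fin.cons q.2 y : Fin (k+1) → ℝ))) := by
      refine ih (V := V × ℝ) (F := fun r => F (r.1.1, (Fin.cons r.1.2 r.2 : Fin (k+1) → ℝ))) ?_ ?_
      · intro r s a b ha hb hab
        have := hF (r.1.1, (Fin.cons r.1.2 r.2 : Fin (k+1) → ℝ))
          (s.1.1, (Fin.cons s.1.2 s.2 : Fin (k+1) → ℝ)) a b ha hb hab
        refine this.trans (le_of_eq ?_)
        congr 1
        ext i
        · simp
        · refine Fin.cases ?_ (fun j => ?_) i <;> simp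
      · intro v
        exact (hm' v.1).comp (measurable_const.prodMk measurable_id : Measurable fun y : Fin k → ℝ => (v.2, y))
    have hGm : ∀ v, Measurable fun t : ℝ => ∫⁻ y : Fin k → ℝ, F (v, (Fin.cons t y : Fin (k+1) → ℝ)) :=
      fun v => (hm' v).lintegral_prod_right'
    intro x y a b ha hb hab
    simp only [hInt]
    refine prekopa_leindler_one_dim (hGm x) (hGm y) (hGm _) ?_ ha hb hab fun s t => ?_
    · intro s t a' b' ha' hb' hab'
      have := hG (a • x + b • y, s) (a • x + b • y, t) a' b' ha' hb' hab'
      have h2 : a' • (a • x + b • y) + b' • (a • x + b • y) = a • x + b • y := by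
        rw [← add_smul, hab', one_smul]
      simpa only [Prod.smul_mk, Prod.mk_add_mk, h2] using this
    · simpa using hG (x, s) (y, t) a b ha hb hab

/-- Log-concavity for nonnegative real functions, zeros allowed. -/
def LogConcaveFun {V : Type*} [AddCommGroup V] [Module ℝ V] (φ : V → ℝ) : Prop :=
  ∀ x y : V, ∀ a b : ℝ, 0 < a → 0 < b → a + b = 1 → φ x ^ a * φ y ^ b ≤ φ (a • x + b • y)

lemma LogConcaveFun.ofReal {V : Type*} [AddCommGroup V] [Module ℝ V] {φ : V → ℝ}
    (h : LogConcaveFun φ) (h0 : ∀ x, 0 ≤ φ x) : LogConcaveENN fun x => ENNReal.ofReal (φ x) := by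
  intro x y a b ha hb hab
  rw [ENNReal.ofReal_rpow_of_nonneg (h0 x) ha.le, ENNReal.ofReal_rpow_of_nonneg (h0 y) hb.le,
    ← ENNReal.ofReal_mul (by have := h0 x; positivity)]
  exact ENNReal.ofReal_le_ofReal (h x y a b ha hb hab)

section Conv

variable {n : ℕ}

local notation "E" => EuclideanSpace ℝ (Fin n)

/-- A bounded integrable measurable nonnegative function. -/
structure IsDensity (φ : EuclideanSpace ℝ (Fin n) → ℝ) : Prop where
  meas : Measurable φ
  nonneg : ∀ x, 0 ≤ φ x
  integrable : Integrable φ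
  bdd : ∃ S, ∀ x, φ x ≤ S

lemma convPow_nonneg {φ : E → ℝ} (h0 : ∀ x, 0 ≤ φ x) (m : ℕ) (x : E) : 0 ≤ convPow n φ m x := by
  induction m generalizing x with
  | zero => exact h0 x
  | succ m ih => exact integral_nonneg fun y => mul_nonneg (ih _) (h0 y)

lemma convPow_measurable {φ : E → ℝ} (hm : Measurable φ) (m : ℕ) : Measurable (convPow n φ m) := by
  induction m with
  | zero => exact hm
  | succ m ih =>
    have : StronglyMeasurable (fun p : E × E => convPow n φ m (p.1 - p.2) * φ p.2) :=
      ((ih.comp (measurable_fst.sub measurable_snd)).mul (hm.comp measurable_snd)).stronglyMeasurable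
    exact this.integral_prod_right'.measurable

/-- Chernoff bound for convolution powers. -/
lemma convPow_le_exp {φ : E → ℝ} (h0 : ∀ x, 0 ≤ φ x) (l : E →L[ℝ] ℝ) {S M : ℝ} (hS0 : 0 ≤ S)
    (hM0 : 0 ≤ M)
    (hS : ∀ x, φ x * exp (l x) ≤ S) (hi : Integrable fun x => φ x * exp (l x))
    (hM : ∫ x, φ x * exp (l x) ≤ M) (m : ℕ) (x : E) :
    convPow n φ m x ≤ S * M ^ m * exp (-l x) := by
  induction m generalizing x with
  | zero =>
    have := hS x
    rw [exp_neg, ← div_eq_mul_inv, le_div_iff₀ (exp_pos _)]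
    simpa [convPow] using this
  | succ m ih =>
    have h1 : convPow n φ (m + 1) x ≤ ∫ y, S * M ^ m * exp (-l x) * (φ y * exp (l y)) := by
      refine integral_mono_of_nonneg
        (Eventually.of_forall fun y => mul_nonneg (convPow_nonneg h0 m _) (h0 y))
        (hi.const_mul _) (Eventually.of_forall fun y => ?_)
      calc convPow n φ m (x - y) * φ y ≤ (S * M ^ m * exp (-l (x - y))) * φ y :=
            mul_le_mul_of_nonneg_right (ih _) (h0 y)
        _ = S * M ^ m * exp (-l x) * (φ y * exp (l y)) := by
            rw [map_sub, neg_sub, sub_eq_add_neg, exp_add]; ring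
    rw [integral_const_mul] at h1
    refine h1.trans ?_
    calc _ ≤ S * M ^ m * exp (-l x) * M := by gcongr
      _ = _ := by ring

lemma IsDensity.convPow_bdd {φ : E → ℝ} (h : IsDensity φ) (m : ℕ) :
    ∃ S, ∀ x, convPow n φ m x ≤ S := by
  obtain ⟨S, hS⟩ := h.bdd
  have hS0 : 0 ≤ S := (h.nonneg 0).trans (hS 0)
  refine ⟨S * (∫ x, φ x) ^ m, fun x => ?_⟩
  have := convPow_le_exp (M := ∫ x, φ x) h.nonneg 0 hS0 (integral_nonneg h.nonneg) (by simpa using hS)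
    (by simpa using h.integrable) (by simp) m x
  simpa using this

lemma IsDensity.integrand_integrable {φ ψ : E → ℝ} (hφ : IsDensity φ) (hψ : Measurable ψ)
    (hψ0 : ∀ x, 0 ≤ ψ x) (hψb : ∃ S, ∀ x, ψ x ≤ S) (x : E) :
    Integrable fun y => ψ (x - y) * φ y := by
  obtain ⟨S, hS⟩ := hψb
  refine hφ.integrable.bdd_mul (c := S) ?_ (Eventually.of_forall fun y => ?_)
  · exact (hψ.comp (measurable_const.sub measurable_id)).aestronglyMeasurable
  · rw [Real.norm_of_nonneg (hψ0 _)]; exact hS _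

lemma IsDensity.convPow_integrand {φ : E → ℝ} (hφ : IsDensity φ) (m : ℕ) (x : E) :
    Integrable fun y => convPow n φ m (x - y) * φ y :=
  hφ.integrand_integrable (convPow_measurable hφ.meas m) (convPow_nonneg hφ.nonneg m)
    (hφ.convPow_bdd m) x

lemma convPow_succ_eq_convolution (φ : E → ℝ) (m : ℕ) :
    convPow n φ (m + 1) =
      convolution φ (convPow n φ m) (ContinuousLinearMap.mul ℝ ℝ) volume := by
  ext x
  simp only [convPow, convolution, ContinuousLinearMap.mul_apply']
  exact integral_congr_ae (Eventually.of_forall fun y => mul_comm _ _)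

lemma IsDensity.convPow_integrable {φ : E → ℝ} (hφ : IsDensity φ) (m : ℕ) :
    Integrable (convPow n φ m) ∧ ∫ x, convPow n φ m x = (∫ x, φ x) ^ (m + 1) := by
  induction m with
  | zero => exact ⟨hφ.integrable, by simp [convPow]⟩
  | succ m ih =>
    rw [convPow_succ_eq_convolution]
    refine ⟨hφ.integrable.integrable_convolution _ ih.1, ?_⟩
    rw [integral_convolution _ hφ.integrable ih.1, ih.2]
    simp [pow_succ]; ring

lemma convPow_mono {h φ : E → ℝ} (h0 : ∀ x, 0 ≤ h x) (hφ : IsDensity φ) (hle : ∀ x, h x ≤ φ x)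
    (m : ℕ) (x : E) : convPow n h m x ≤ convPow n φ m x := by
  induction m generalizing x with
  | zero => exact hle x
  | succ m ih =>
    refine integral_mono_of_nonneg
      (Eventually.of_forall fun y => mul_nonneg (convPow_nonneg h0 m _) (h0 y))
      (hφ.convPow_integrand m x) (Eventually.of_forall fun y => ?_)
    exact mul_le_mul (ih _) (hle y) (h0 y) (convPow_nonneg hφ.nonneg m _)

lemma integral_comp_add_smul (g : E → ℝ) (b : E) {s : ℝ} (hs : 0 < s) :
    ∫ y, g y = s ^ n * ∫ u, g (b + s • u) := by
  have h1 := Measure.integral_comp_smul (volume : Measure E) (fun y => g (b + y)) s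
  rw [h1, integral_add_left_eq_self, finrank_euclideanSpace_fin, abs_of_pos (by positivity),
    smul_eq_mul, ← mul_assoc, mul_inv_cancel₀ (by positivity), one_mul]

/-- Convolution powers under an affine change of variables and an exponential tilt. -/
lemma convPow_affine {p φ : E → ℝ} {b : E} {s A : ℝ} (hs : 0 < s) (l : E →L[ℝ] ℝ)
    (h : ∀ u, p (b + s • u) = A * exp (l u) * φ u) (m : ℕ) (v : E) :
    convPow n p m (((m : ℝ) + 1) • b + s • v) =
      s ^ (n * m) * A ^ (m + 1) * exp (l v) * convPow n φ m v := by
  induction m generalizing v with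
  | zero => simpa [convPow] using h v
  | succ m ih =>
    simp only [convPow]
    rw [integral_comp_add_smul _ b hs, ← integral_const_mul, ← integral_const_mul]
    refine integral_congr_ae (Eventually.of_forall fun u => ?_)
    have e : (((m + 1 : ℕ) : ℝ) + 1) • b + s • v - (b + s • u) =
        ((m : ℝ) + 1) • b + s • (v - u) := by
      push_cast
      module
    simp only
    rw [e, ih, h, map_sub, sub_eq_add_neg, exp_add, exp_neg]
    have := (exp_pos (l u)).ne'
    field_simp
    ring

lemma LogConcaveFun.convPow_logConcave {φ : E → ℝ} (hl : LogConcaveFun φ) (hφ : IsDensity φ) (m : ℕ) :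
    LogConcaveFun (convPow n φ m) := by
  induction m with
  | zero => exact hl
  | succ m ih =>
    have h1 := ih.ofReal (convPow_nonneg hφ.nonneg m)
    have h2 := hl.ofReal hφ.nonneg
    let T : (Fin n → ℝ) → E := fun y => (WithLp.toLp 2 y)
    have hT : ∀ (a b : ℝ) y z, T (a • y + b • z) = a • T y + b • T z := fun a b y z => rfl
    have h3 : LogConcaveENN (fun q : E × (Fin n → ℝ) =>
        ENNReal.ofReal (convPow n φ m (q.1 - T q.2)) * ENNReal.ofReal (φ (T q.2))) := by
      intro q r a b ha hb hab
      rw [ENNReal.mul_rpow_of_nonneg _ _ ha.le, ENNReal.mul_rpow_of_nonneg _ _ hb.le, mul_mul_mul_comm]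
      refine mul_le_mul' ((h1 _ _ a b ha hb hab).trans (le_of_eq ?_))
        ((h2 _ _ a b ha hb hab).trans (le_of_eq ?_))
      · congr 2
        simp only [Prod.fst_add, Prod.snd_add, Prod.smul_fst, Prod.smul_snd, hT]
        module
      · simp only [Prod.snd_add, Prod.smul_snd, hT]
    have hTm : Measurable T := WithLp.measurable_toLp 2 _
    have h4 := LogConcaveENN.lintegral_pi n h3 (fun v =>
      (((convPow_measurable hφ.meas m).comp (measurable_const.sub hTm)).ennreal_ofReal).mul
        (hφ.meas.comp hTm).ennreal_ofReal)
    have h5 : ∀ x, ENNReal.ofReal (convPow n φ (m + 1) x) = ∫⁻ y : Fin n → ℝ,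
        ENNReal.ofReal (convPow n φ m (x - T y)) * ENNReal.ofReal (φ (T y)) := by
      intro x
      simp only [convPow]
      rw [ofReal_integral_eq_lintegral_ofReal (hφ.convPow_integrand m x)
        (Eventually.of_forall fun y => mul_nonneg (convPow_nonneg hφ.nonneg m _) (hφ.nonneg y)),
        ← (PiLp.volume_preserving_toLp (Fin n)).lintegral_comp]
      · refine lintegral_congr fun y => ?_
        rw [ENNReal.ofReal_mul (convPow_nonneg hφ.nonneg m _)]
      · exact (((convPow_measurable hφ.meas m).comp (measurable_const.sub measurable_id)).mul
          hφ.meas).ennreal_ofReal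
    intro x y a b ha hb hab
    have h6 := h4 x y a b ha hb hab
    simp only [← h5] at h6
    have hx := convPow_nonneg hφ.nonneg (m + 1) x
    have hy := convPow_nonneg hφ.nonneg (m + 1) y
    rw [ENNReal.ofReal_rpow_of_nonneg hx ha.le, ENNReal.ofReal_rpow_of_nonneg hy hb.le,
      ← ENNReal.ofReal_mul (by positivity)] at h6
    exact (ENNReal.ofReal_le_ofReal_iff (convPow_nonneg hφ.nonneg (m + 1) _)).1 h6

end Conv

lemma Real.exp_le_one_add_add_sq_mul_exp_abs (x : ℝ) : exp x ≤ 1 + x + x ^ 2 * exp |x| := by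
  have h1 : exp x * (1 - x) ≤ 1 := by
    have := one_sub_le_exp_neg x
    calc exp x * (1 - x) ≤ exp x * exp (-x) := by gcongr
      _ = 1 := by rw [← exp_add]; simp
  have h2 : x * (exp x - 1) ≤ x ^ 2 * exp |x| := by
    rcases le_total 0 x with hx | hx
    · rw [abs_of_nonneg hx]; nlinarith
    · have h3 : 1 ≤ exp |x| := one_le_exp (abs_nonneg x)
      nlinarith [add_one_le_exp x, sq_nonneg x]
  linarith

lemma Real.sq_le_two_mul_exp {t : ℝ} (ht : 0 ≤ t) : t ^ 2 ≤ 2 * exp t := by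
  have := pow_div_factorial_le_exp t ht 2
  norm_num [Nat.factorial] at this
  linarith

section Gauss

variable {n : ℕ}

local notation "E" => EuclideanSpace ℝ (Fin n)

lemma integrable_exp_neg_norm : Integrable fun u : E => exp (-‖u‖) := by
  have h1 : Integrable fun u : E => (1 + ‖u‖) ^ (-((n : ℝ) + 1)) := by
    apply integrable_one_add_norm
    rw [finrank_euclideanSpace_fin]; linarith
  refine (h1.const_mul ((Nat.factorial (n + 1) : ℝ) * exp 1)).mono'
    (by fun_prop) (Eventually.of_forall fun u => ?_)
  have h2 := pow_div_factorial_le_exp (x := 1 + ‖u‖) (by positivity) (n + 1)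
  have h3 : (1 + ‖u‖) ^ (-((n : ℝ) + 1)) = ((1 + ‖u‖) ^ (n + 1))⁻¹ := by
    rw [rpow_neg (by positivity)]
    congr 1
    exact_mod_cast rpow_natCast (1 + ‖u‖) (n + 1)
  rw [Real.norm_of_nonneg (exp_pos _).le, h3, ← div_eq_mul_inv, le_div_iff₀ (by positivity)]
  rw [div_le_iff₀ (by positivity)] at h2
  calc exp (-‖u‖) * (1 + ‖u‖) ^ (n + 1)
      ≤ exp (-‖u‖) * (exp (1 + ‖u‖) * (Nat.factorial (n + 1) : ℝ)) := by gcongr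
    _ = (exp (-‖u‖) * exp (1 + ‖u‖)) * (Nat.factorial (n + 1) : ℝ) := by ring
    _ = _ := by rw [← exp_add]; ring_nf

variable [NeZero n]

/-- Inverse variances of the limiting Gaussian law. -/
def gaussWeight (n : ℕ) [NeZero n] (β : ℝ) (i : Fin n) : ℝ := if i = 0 then 1 else β⁻¹

/-- Quadratic form of the limiting Gaussian law. -/
def gaussQuad (β : ℝ) (u : E) : ℝ := (∑ i, gaussWeight n β i * u i ^ 2) / 2

/-- The limiting Gaussian density. -/
def gaussDens (β : ℝ) (u : E) : ℝ :=
  (2 * π) ^ (-(n : ℝ) / 2) * β ^ (-((n : ℝ) - 1) / 2) * exp (-gaussQuad β u)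

lemma gaussWeight_pos {β : ℝ} (hβ : 0 < β) (i : Fin n) : 0 < gaussWeight n β i := by
  unfold gaussWeight; split_ifs <;> positivity

lemma gaussQuad_eq (β : ℝ) (u : E) :
    gaussQuad β u = (u 0 ^ 2 + β⁻¹ * ∑ i ∈ Finset.univ.erase (0 : Fin n), u i ^ 2) / 2 := by
  unfold gaussQuad
  rw [← Finset.add_sum_erase _ _ (Finset.mem_univ (0 : Fin n)), Finset.mul_sum]
  congr 2
  · simp [gaussWeight]
  · refine Finset.sum_congr rfl fun i hi => ?_
    simp [gaussWeight, Finset.ne_of_mem_erase hi]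

lemma exists_gaussQuad_bounds {β : ℝ} (hβ : 0 < β) :
    ∃ q > 0, ∃ q' > 0, ∀ u : E, q * ‖u‖ ^ 2 ≤ gaussQuad β u ∧ gaussQuad β u ≤ q' * ‖u‖ ^ 2 := by
  have hb : 0 < β⁻¹ := inv_pos.2 hβ
  have h1 : ∀ i : Fin n, min 1 β⁻¹ ≤ gaussWeight n β i ∧ gaussWeight n β i ≤ max 1 β⁻¹ := by
    intro i; unfold gaussWeight; split_ifs <;> simp
  refine ⟨min 1 β⁻¹ / 2, by positivity, max 1 β⁻¹ / 2, by positivity, fun u => ?_⟩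
  rw [EuclideanSpace.real_norm_sq_eq, gaussQuad, div_mul_eq_mul_div, div_mul_eq_mul_div,
    Finset.mul_sum, Finset.mul_sum]
  constructor
  · gcongr with i _; exact (h1 i).1
  · gcongr with i _; exact (h1 i).2

lemma gaussQuad_neg (β : ℝ) (u : E) : gaussQuad β (-u) = gaussQuad β u := by
  simp [gaussQuad]

lemma gaussQuad_continuous (β : ℝ) : Continuous (gaussQuad β : E → ℝ) := by
  unfold gaussQuad; fun_prop

lemma exists_gaussQuad_add (β : ℝ) (b : E) :
    ∃ l : E →L[ℝ] ℝ, ∀ u, gaussQuad β (b + u) = gaussQuad β b + l u + gaussQuad β u := by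
  refine ⟨∑ i, (gaussWeight n β i * b i) • (EuclideanSpace.proj i : E →L[ℝ] ℝ), fun u => ?_⟩
  simp only [gaussQuad, sum_apply, smul_apply, PiLp.proj_apply, smul_eq_mul, PiLp.add_apply,
    Finset.sum_div]
  rw [← Finset.sum_add_distrib, ← Finset.sum_add_distrib]
  exact Finset.sum_congr rfl fun i _ => by ring

lemma gaussQuad_convex {β : ℝ} (hβ : 0 < β) (x y : E) {a b : ℝ} (ha : 0 < a) (hb : 0 < b)
    (hab : a + b = 1) :
    gaussQuad β (a • x + b • y) ≤ a * gaussQuad β x + b * gaussQuad β y := by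
  simp only [gaussQuad]
  rw [mul_div_assoc', mul_div_assoc', ← add_div, Finset.mul_sum, Finset.mul_sum,
    ← Finset.sum_add_distrib]
  gcongr with i _
  have hw := (gaussWeight_pos hβ i).le
  simp only [PiLp.add_apply, PiLp.smul_apply, smul_eq_mul]
  obtain rfl : b = 1 - a := by linarith
  have h : 0 ≤ gaussWeight n β i * (a * (1 - a) * (x i - y i) ^ 2) := by positivity
  nlinarith

variable {β : ℝ}

lemma gaussDens_pos (hβ : 0 < β) (u : E) : 0 < gaussDens β u := by
  unfold gaussDens; positivity

lemma gaussDens_le (hβ : 0 < β) (u : E) : gaussDens β u ≤ gaussDens β (0 : E) := by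
  obtain ⟨q, hq, q', hq', h⟩ := exists_gaussQuad_bounds (n := n) hβ
  unfold gaussDens
  gcongr
  have h0 := (h 0).2
  have hu := (h u).1
  have : 0 ≤ q * ‖u‖ ^ 2 := by positivity
  simp at h0
  linarith

lemma gaussDens_neg (u : E) : gaussDens β (-u) = gaussDens β u := by
  simp [gaussDens, gaussQuad_neg]

lemma gaussDens_continuous : Continuous (gaussDens β : E → ℝ) := by
  have := gaussQuad_continuous (n := n) β
  unfold gaussDens; fun_prop

lemma gaussDens_exp_bound (hβ : 0 < β) : ∃ C > 0, ∀ u : E, gaussDens β u * exp (3 * ‖u‖) ≤ C := by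
  obtain ⟨q, hq, q', hq', h⟩ := exists_gaussQuad_bounds (n := n) hβ
  refine ⟨(2 * π) ^ (-(n : ℝ) / 2) * β ^ (-((n : ℝ) - 1) / 2) * exp (9 / (4 * q)), by positivity,
    fun u => ?_⟩
  rw [gaussDens, mul_assoc, ← exp_add]
  gcongr
  have hu := (h u).1
  have : 3 * ‖u‖ - q * ‖u‖ ^ 2 ≤ 9 / (4 * q) := by
    rw [le_div_iff₀ (by positivity)]
    nlinarith [sq_nonneg (2 * q * ‖u‖ - 3)]
  linarith

lemma gaussDens_integrable_exp (hβ : 0 < β) :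
    Integrable fun u : E => gaussDens β u * exp ‖u‖ := by
  obtain ⟨C, hC, h⟩ := gaussDens_exp_bound (n := n) hβ
  have hc := gaussDens_continuous (n := n) (β := β)
  refine (integrable_exp_neg_norm.const_mul C).mono' (by fun_prop)
    (Eventually.of_forall fun u => ?_)
  have hp := gaussDens_pos hβ u
  rw [Real.norm_of_nonneg (by positivity)]
  calc gaussDens β u * exp ‖u‖ ≤ gaussDens β u * exp (3 * ‖u‖ + -‖u‖) := by
        gcongr; linarith [norm_nonneg u]
    _ = gaussDens β u * exp (3 * ‖u‖) * exp (-‖u‖) := by rw [exp_add]; ring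
    _ ≤ C * exp (-‖u‖) := by gcongr; exact h u

lemma gaussDens_integrable_sq_exp (hβ : 0 < β) :
    Integrable fun u : E => ‖u‖ ^ 2 * exp ‖u‖ * gaussDens β u := by
  obtain ⟨C, hC, h⟩ := gaussDens_exp_bound (n := n) hβ
  have hc := gaussDens_continuous (n := n) (β := β)
  refine (integrable_exp_neg_norm.const_mul (2 * C)).mono' (by fun_prop)
    (Eventually.of_forall fun u => ?_)
  have hp := gaussDens_pos hβ u
  rw [Real.norm_of_nonneg (by positivity)]
  have h2 := Real.sq_le_two_mul_exp (norm_nonneg u)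
  calc ‖u‖ ^ 2 * exp ‖u‖ * gaussDens β u ≤ 2 * exp ‖u‖ * exp ‖u‖ * gaussDens β u := by gcongr
    _ = 2 * (gaussDens β u * exp (3 * ‖u‖)) * exp (-‖u‖) := by
        have : exp (3 * ‖u‖) = exp ‖u‖ * exp ‖u‖ * exp ‖u‖ := by
          rw [← exp_add, ← exp_add]; ring_nf
        rw [this, exp_neg]
        have := (exp_pos ‖u‖).ne'
        field_simp
    _ ≤ 2 * C * exp (-‖u‖) := by gcongr; exact h u

lemma gaussDens_integrable (hβ : 0 < β) : Integrable (gaussDens β : E → ℝ) := by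
  have hc := gaussDens_continuous (n := n) (β := β)
  refine (gaussDens_integrable_exp hβ).mono' (by fun_prop) (Eventually.of_forall fun u => ?_)
  have hp := gaussDens_pos hβ u
  rw [Real.norm_of_nonneg hp.le]
  exact le_mul_of_one_le_right hp.le (one_le_exp (norm_nonneg u))

lemma integral_gaussDens (hβ : 0 < β) : ∫ u : E, gaussDens β u = 1 := by
  unfold gaussDens
  rw [integral_const_mul, ← (PiLp.volume_preserving_toLp (Fin n)).integral_comp
    (MeasurableEquiv.toLp 2 _).measurableEmbedding]
  have h1 : ∀ y : Fin n → ℝ, exp (-gaussQuad β (WithLp.toLp 2 y : E)) =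
      ∏ i, exp (-(gaussWeight n β i / 2) * y i ^ 2) := by
    intro y
    rw [← exp_sum, gaussQuad, Finset.sum_div, ← Finset.sum_neg_distrib]
    congr 1
    exact Finset.sum_congr rfl fun i _ => by simp only; ring
  simp only [h1]
  rw [integral_fintype_prod_volume_eq_prod (f := fun i (v : ℝ) => exp (-(gaussWeight n β i / 2) * v ^ 2))]
  simp only [integral_gaussian]
  have h2 : ∀ i : Fin n, √(π / (gaussWeight n β i / 2)) =
      (2 * π) ^ (1 / 2 : ℝ) * (gaussWeight n β i) ^ (-(1 / 2) : ℝ) := by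
    intro i
    have := gaussWeight_pos hβ i
    rw [sqrt_eq_rpow, show π / (gaussWeight n β i / 2) = (2 * π) * (gaussWeight n β i)⁻¹ by field_simp,
      mul_rpow (by positivity) (by positivity), inv_rpow (by positivity), rpow_neg (by positivity)]
  simp only [h2]
  rw [Finset.prod_mul_distrib, Finset.prod_const, Finset.card_univ, Fintype.card_fin,
    ← Finset.mul_prod_erase _ _ (Finset.mem_univ (0 : Fin n))]
  have h3 : ∏ i ∈ Finset.univ.erase (0 : Fin n), gaussWeight n β i ^ (-(1 / 2) : ℝ) =
      β ^ (((n : ℝ) - 1) / 2) := by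
    rw [Finset.prod_congr rfl (g := fun _ => β ^ (1 / 2 : ℝ)), Finset.prod_const,
      Finset.card_erase_of_mem (Finset.mem_univ _), Finset.card_univ, Fintype.card_fin,
      ← rpow_natCast, ← rpow_mul hβ.le, Nat.cast_sub (Nat.one_le_iff_ne_zero.2 (NeZero.ne n))]
    · congr 1; push_cast; ring
    · intro i hi
      simp only [gaussWeight, Finset.ne_of_mem_erase hi, if_false]
      rw [inv_rpow hβ.le, rpow_neg hβ.le, inv_inv]
  rw [h3, ← rpow_natCast, ← rpow_mul (by positivity)]
  simp only [gaussWeight, if_true, one_rpow, one_mul]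
  rw [mul_mul_mul_comm, ← rpow_add (by positivity), ← rpow_add hβ]
  ring_nf
  simp

/-- Exponential moments of order `k` of the norm under the Gaussian density. -/
def gaussMoment (n : ℕ) [NeZero n] (β k : ℝ) : ℝ :=
  ∫ u : EuclideanSpace ℝ (Fin n), gaussDens β u * exp (k * ‖u‖)

lemma gaussMoment_tendsto (hβ : 0 < β) : Tendsto (gaussMoment n β) (𝓝[>] 0) (𝓝 1) := by
  have hc := gaussDens_continuous (n := n) (β := β)
  rw [← integral_gaussDens (n := n) hβ]
  refine tendsto_integral_filter_of_dominated_convergence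
    (fun u : E => gaussDens β u * exp ‖u‖) (Eventually.of_forall fun k => by fun_prop) ?_
    (gaussDens_integrable_exp hβ) (Eventually.of_forall fun u => ?_)
  · have : Iio (1 : ℝ) ∈ 𝓝[>] (0 : ℝ) := mem_nhdsWithin_of_mem_nhds (Iio_mem_nhds one_pos)
    filter_upwards [this] with k hk
    refine Eventually.of_forall fun u => ?_
    have hp := gaussDens_pos hβ u
    rw [Real.norm_of_nonneg (by positivity)]
    gcongr
    nlinarith [norm_nonneg u, mem_Iio.1 hk]
  · have : Tendsto (fun k : ℝ => gaussDens β u * exp (k * ‖u‖)) (𝓝 0) (𝓝 (gaussDens β u)) := by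
      have : Continuous (fun k : ℝ => gaussDens β u * exp (k * ‖u‖)) := by fun_prop
      simpa using this.tendsto 0
    exact this.mono_left nhdsWithin_le_nhds

/-- The Laplace transform of the Gaussian density is quadratic near `0`. -/
lemma exists_gauss_laplace_bound (hβ : 0 < β) : ∃ C > 0, ∀ w : E, ‖w‖ ≤ 1 →
    (Integrable fun u : E => gaussDens β u * exp ⟪w, u⟫) ∧
      ∫ u : E, gaussDens β u * exp ⟪w, u⟫ ≤ 1 + C * ‖w‖ ^ 2 := by
  have hc := gaussDens_continuous (n := n) (β := β)
  have hC0 : 0 ≤ ∫ u : E, ‖u‖ ^ 2 * exp ‖u‖ * gaussDens β u :=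
    integral_nonneg fun u => by have := gaussDens_pos hβ u; positivity
  refine ⟨(∫ u : E, ‖u‖ ^ 2 * exp ‖u‖ * gaussDens β u) + 1, by positivity, fun w hw => ?_⟩
  have hin : ∀ u : E, |⟪w, u⟫| ≤ ‖w‖ * ‖u‖ := fun u => abs_real_inner_le_norm w u
  have hi : Integrable fun u : E => gaussDens β u * exp ⟪w, u⟫ := by
    refine (gaussDens_integrable_exp hβ).mono' (by fun_prop) (Eventually.of_forall fun u => ?_)
    have hp := gaussDens_pos hβ u
    rw [Real.norm_of_nonneg (by positivity)]
    gcongr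
    nlinarith [norm_nonneg u, hin u, le_abs_self ⟪w, u⟫]
  have hi2 : Integrable fun u : E => gaussDens β u * ⟪w, u⟫ := by
    refine (gaussDens_integrable_exp hβ).mono' (by fun_prop) (Eventually.of_forall fun u => ?_)
    have hp := gaussDens_pos hβ u
    rw [norm_mul, Real.norm_of_nonneg hp.le, Real.norm_eq_abs]
    gcongr
    nlinarith [norm_nonneg u, hin u, add_one_le_exp ‖u‖]
  have hz : ∫ u : E, gaussDens β u * ⟪w, u⟫ = 0 := by
    have h := integral_neg_eq_self (fun u : E => gaussDens β u * ⟪w, u⟫) volume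
    simp only [gaussDens_neg, inner_neg_right, mul_neg, integral_neg] at h
    linarith
  refine ⟨hi, ?_⟩
  calc ∫ u : E, gaussDens β u * exp ⟪w, u⟫
      ≤ ∫ u : E, (gaussDens β u + gaussDens β u * ⟪w, u⟫ +
          ‖w‖ ^ 2 * (‖u‖ ^ 2 * exp ‖u‖ * gaussDens β u)) := by
        refine integral_mono hi (((gaussDens_integrable hβ).add hi2).add
          ((gaussDens_integrable_sq_exp hβ).const_mul _)) fun u => ?_
        have hp := gaussDens_pos hβ u
        have h1 := Real.exp_le_one_add_add_sq_mul_exp_abs ⟪w, u⟫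
        have h2 : ⟪w, u⟫ ^ 2 ≤ ‖w‖ ^ 2 * ‖u‖ ^ 2 := by
          rw [← sq_abs, ← mul_pow]; gcongr; exact hin u
        have h3 : exp |⟪w, u⟫| ≤ exp ‖u‖ := by
          gcongr; nlinarith [norm_nonneg u, hin u]
        have h4 : ⟪w, u⟫ ^ 2 * exp |⟪w, u⟫| ≤ ‖w‖ ^ 2 * ‖u‖ ^ 2 * exp ‖u‖ := by gcongr
        calc gaussDens β u * exp ⟪w, u⟫
            ≤ gaussDens β u * (1 + ⟪w, u⟫ + ‖w‖ ^ 2 * ‖u‖ ^ 2 * exp ‖u‖) := by gcongr; linarith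
          _ = _ := by ring
    _ = 1 + ‖w‖ ^ 2 * ∫ u : E, ‖u‖ ^ 2 * exp ‖u‖ * gaussDens β u := by
        have hi3 : Integrable fun u : E => gaussDens β u + gaussDens β u * ⟪w, u⟫ :=
          (gaussDens_integrable hβ).add hi2
        rw [integral_add hi3
          ((gaussDens_integrable_sq_exp hβ).const_mul _),
          integral_add (gaussDens_integrable hβ) hi2, integral_gaussDens hβ, hz, integral_const_mul]
        ring
    _ ≤ _ := by nlinarith [sq_nonneg ‖w‖]

end Gauss

lemma LogConcaveFun.le_log {V : Type*} [AddCommGroup V] [Module ℝ V] {φ : V → ℝ}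
    (h : LogConcaveFun φ) {x y : V} (hx : 0 < φ x) (hy : 0 < φ y) {a b : ℝ} (ha : 0 ≤ a)
    (hb : 0 ≤ b) (hab : a + b = 1) :
    a * log (φ x) + b * log (φ y) ≤ log (φ (a • x + b • y)) := by
  rcases ha.eq_or_lt with rfl | ha
  · obtain rfl : b = 1 := by linarith
    simp
  rcases hb.eq_or_lt with rfl | hb
  · obtain rfl : a = 1 := by linarith
    simp
  rw [← log_rpow hx, ← log_rpow hy, ← log_mul (by positivity) (by positivity)]
  exact log_le_log (by positivity) (h x y a b ha hb hab)

section Family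

variable {n : ℕ} [NeZero n]

local notation "E" => EuclideanSpace ℝ (Fin n)

lemma log_gaussDens {β : ℝ} (hβ : 0 < β) (u : E) :
    log (gaussDens β u) = log (gaussDens β (0 : E)) - gaussQuad β u := by
  have h0 : gaussDens β u = gaussDens β (0 : E) * exp (-gaussQuad β u) := by
    simp [gaussDens, gaussQuad]
  rw [h0, log_mul (gaussDens_pos hβ 0).ne' (exp_pos _).ne', log_exp]; ring

/-- A log-concave function close to the Gaussian density on a large ball has a small tail. -/
lemma exists_tail_bound {β : ℝ} (hβ : 0 < β) : ∃ R₀ > 0, ∀ R ≥ R₀, ∀ φ : E → ℝ,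
    LogConcaveFun φ → (∀ u, 0 ≤ φ u) →
    (∀ u, ‖u‖ ≤ R → exp (-1) * gaussDens β u ≤ φ u ∧ φ u ≤ exp 1 * gaussDens β u) →
    ∀ u, R ≤ ‖u‖ → φ u ≤ gaussDens β (0 : E) * exp (-3 * ‖u‖) := by
  obtain ⟨q, hq, q', hq', hQ⟩ := exists_gaussQuad_bounds (n := n) hβ
  have hG0 := gaussDens_pos hβ (0 : E)
  refine ⟨1 + 5 / q, by positivity, fun R hR φ hl h0 hc u hu => ?_⟩
  have hR1 : 1 ≤ R := le_trans (by have : 0 < 5 / q := by positivity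
                                   linarith) hR
  have hqR : 5 ≤ q * R := by
    have : q * (1 + 5 / q) ≤ q * R := by gcongr
    have : q * (1 + 5 / q) = q + 5 := by field_simp
    linarith
  have hr : 0 < ‖u‖ := by linarith
  rcases (h0 u).eq_or_lt with h | hpos
  · rw [← h]; positivity
  have hlow : log (gaussDens β (0 : E)) - 1 ≤ log (φ 0) := by
    have h1 := (hc 0 (by simp; linarith)).1
    have h2 := log_le_log (by positivity) h1
    rw [log_mul (exp_pos _).ne' hG0.ne', log_exp] at h2
    linarith
  have hφ0 : 0 < φ 0 := lt_of_lt_of_le (by positivity) (hc 0 (by simp; linarith)).1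
  have ha : R / ‖u‖ ≤ 1 := (div_le_one hr).2 hu
  have hv := hl.le_log hpos hφ0 (a := R / ‖u‖) (b := 1 - R / ‖u‖) (by positivity) (by linarith)
    (by ring)
  rw [smul_zero, add_zero] at hv
  set v := (R / ‖u‖) • u with hv_def
  have hvn : ‖v‖ = R := by
    rw [hv_def, norm_smul, Real.norm_of_nonneg (by positivity), div_mul_cancel₀ _ hr.ne']
  have hup : log (φ v) ≤ 1 + log (gaussDens β (0 : E)) - q * R ^ 2 := by
    have h1 := (hc v hvn.le)
    have hGv := gaussDens_pos hβ v
    have h2 := log_le_log (lt_of_lt_of_le (by positivity) h1.1) h1.2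
    rw [log_mul (exp_pos _).ne' hGv.ne', log_exp, log_gaussDens hβ] at h2
    have := (hQ v).1
    rw [hvn] at this
    linarith
  have key : (R / ‖u‖) * (log (φ u) - log (gaussDens β (0 : E))) ≤ 2 - q * R ^ 2 := by
    nlinarith [mul_le_mul_of_nonneg_left hlow (sub_nonneg.2 ha),
      show 0 ≤ R / ‖u‖ by positivity]
  have key2 : log (φ u) - log (gaussDens β (0 : E)) ≤ -3 * ‖u‖ := by
    have h1 : R * (log (φ u) - log (gaussDens β (0 : E))) ≤ (2 - q * R ^ 2) * ‖u‖ := by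
      rw [div_mul_eq_mul_div, div_le_iff₀ hr] at key; exact key
    have h2 : (2 - q * R ^ 2) ≤ -3 * R := by nlinarith
    have h3 : R * (log (φ u) - log (gaussDens β (0 : E))) ≤ R * (-3 * ‖u‖) := by nlinarith
    exact le_of_mul_le_mul_left h3 (by linarith)
  calc φ u = exp (log (φ u)) := (exp_log hpos).symm
    _ ≤ exp (log (gaussDens β (0 : E)) + -3 * ‖u‖) := exp_le_exp.2 (by linarith)
    _ = _ := by rw [exp_add, exp_log hG0]

/-- A family of log-concave densities converging locally uniformly to a Gaussian density. -/
structure TendstoGauss {ι : Type*} (l : Filter ι) (φ : ι → EuclideanSpace ℝ (Fin n) → ℝ)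
    (β : ℝ) : Prop where
  pos : 0 < β
  dens : ∀ᶠ i in l, IsDensity (φ i)
  logConcave : ∀ᶠ i in l, LogConcaveFun (φ i)
  close : ∀ R η : ℝ, 0 < η → ∀ᶠ i in l, ∀ u, ‖u‖ ≤ R →
    exp (-η) * gaussDens β u ≤ φ i u ∧ φ i u ≤ exp η * gaussDens β u

variable {ι : Type*} {l : Filter ι} {φ : ι → EuclideanSpace ℝ (Fin n) → ℝ} {β : ℝ}

lemma TendstoGauss.exists_sup_bound (h : TendstoGauss l φ β) :
    ∃ S > 0, ∀ᶠ i in l, ∀ u, φ i u * exp ‖u‖ ≤ S := by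
  obtain ⟨R, hR, ht⟩ := exists_tail_bound (n := n) h.pos
  obtain ⟨C, hC, hCb⟩ := gaussDens_exp_bound (n := n) h.pos
  have hG0 := gaussDens_pos h.pos (0 : E)
  refine ⟨exp 1 * C + gaussDens β (0 : E), by positivity, ?_⟩
  filter_upwards [h.dens, h.logConcave, h.close R 1 one_pos] with i hd hl hc u
  rcases le_total ‖u‖ R with hu | hu
  · have hGu := gaussDens_pos h.pos u
    calc φ i u * exp ‖u‖ ≤ exp 1 * gaussDens β u * exp (3 * ‖u‖) := by
          gcongr
          · exact (hc u hu).2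
          · linarith [norm_nonneg u]
      _ = exp 1 * (gaussDens β u * exp (3 * ‖u‖)) := by ring
      _ ≤ exp 1 * C := by gcongr; exact hCb u
      _ ≤ _ := by linarith
  · calc φ i u * exp ‖u‖ ≤ gaussDens β (0 : E) * exp (-3 * ‖u‖) * exp ‖u‖ := by
          gcongr; exact ht R le_rfl _ hl hd.nonneg hc u hu
      _ = gaussDens β (0 : E) * exp (-2 * ‖u‖) := by
          rw [mul_assoc, ← exp_add]; ring_nf
      _ ≤ gaussDens β (0 : E) * 1 := by
          gcongr; rw [exp_le_one_iff]; nlinarith [norm_nonneg u]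
      _ ≤ _ := by have : 0 < exp 1 * C := by positivity
                  linarith

lemma TendstoGauss.integral_mul_le (h : TendstoGauss l φ β) {δ : ℝ} (hδ : 0 < δ) :
    ∀ᶠ i in l, ∀ ω : E → ℝ, Measurable ω → (∀ u, 0 ≤ ω u) → (∀ u, ω u ≤ exp ‖u‖) →
      (Integrable fun u => φ i u * ω u) ∧
        ∫ u, φ i u * ω u ≤ (∫ u, gaussDens β u * ω u) + δ := by
  obtain ⟨R₀, hR₀, ht⟩ := exists_tail_bound (n := n) h.pos
  have hG0 := gaussDens_pos h.pos (0 : E)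
  have hI1 := gaussDens_integrable_exp (n := n) h.pos
  have hI2 := integrable_exp_neg_norm (n := n)
  set J := ∫ u : E, gaussDens β u * exp ‖u‖
  set J' := ∫ u : E, exp (-‖u‖)
  have t1 : Tendsto (fun η : ℝ => (exp η - 1) * J) (𝓝[>] 0) (𝓝 0) := by
    have : Continuous fun η : ℝ => (exp η - 1) * J := by fun_prop
    simpa using (this.tendsto 0).mono_left nhdsWithin_le_nhds
  have t2 : Tendsto (fun R : ℝ => gaussDens β (0 : E) * exp (-R) * J') atTop (𝓝 0) := by
    simpa using ((tendsto_exp_neg_atTop_nhds_zero).const_mul (gaussDens β (0 : E))).mul_const J'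
  obtain ⟨η, hη1, hη0⟩ := ((t1.eventually (gt_mem_nhds (half_pos hδ))).and
    (eventually_mem_nhdsWithin)).exists
  obtain ⟨R, hR1, hR2⟩ := ((t2.eventually (gt_mem_nhds (half_pos hδ))).and
    (eventually_ge_atTop R₀)).exists
  rw [mem_Ioi] at hη0
  filter_upwards [h.dens, h.logConcave, h.close R η hη0, h.close R 1 one_pos]
    with i hd hl hc hc1 ω hωm hω0 hωb
  have hGi : Integrable fun u : E => gaussDens β u * ω u := by
    refine hI1.mono' ((gaussDens_continuous.measurable).mul hωm).aestronglyMeasurable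
      (Eventually.of_forall fun u => ?_)
    have hp := gaussDens_pos h.pos u
    rw [Real.norm_of_nonneg (mul_nonneg hp.le (hω0 u))]
    exact mul_le_mul_of_nonneg_left (hωb u) hp.le
  have hη3 : 0 ≤ exp η - 1 := by linarith [one_le_exp hη0.le]
  have hb : ∀ u, φ i u * ω u ≤ gaussDens β u * ω u + (exp η - 1) * (gaussDens β u * exp ‖u‖) +
      gaussDens β (0 : E) * exp (-R) * exp (-‖u‖) := by
    intro u
    have hp := gaussDens_pos h.pos u
    have e1 : 0 ≤ gaussDens β u * ω u := mul_nonneg hp.le (hω0 u)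
    have e2 : 0 ≤ (exp η - 1) * (gaussDens β u * exp ‖u‖) := by positivity
    have e3 : 0 ≤ gaussDens β (0 : E) * exp (-R) * exp (-‖u‖) := by positivity
    rcases le_total ‖u‖ R with hu | hu
    · have h1 := mul_le_mul_of_nonneg_right (hc u hu).2 (hω0 u)
      have h2 : (exp η - 1) * (gaussDens β u * ω u) ≤
          (exp η - 1) * (gaussDens β u * exp ‖u‖) := by gcongr; exact hωb u
      linarith
    · have h1 : φ i u * ω u ≤ gaussDens β (0 : E) * exp (-3 * ‖u‖) * exp ‖u‖ :=
        mul_le_mul (ht R hR2 _ hl hd.nonneg hc1 u hu) (hωb u) (hω0 u) (by positivity)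
      have h2 : gaussDens β (0 : E) * exp (-3 * ‖u‖) * exp ‖u‖ ≤
          gaussDens β (0 : E) * exp (-R) * exp (-‖u‖) := by
        rw [mul_assoc, mul_assoc, ← exp_add, ← exp_add]
        exact mul_le_mul_of_nonneg_left (exp_le_exp.2 (by linarith)) hG0.le
      linarith
  have hBi : Integrable fun u : E => gaussDens β u * ω u +
      (exp η - 1) * (gaussDens β u * exp ‖u‖) := hGi.add (hI1.const_mul _)
  have hBi' : Integrable fun u : E => gaussDens β u * ω u +
      (exp η - 1) * (gaussDens β u * exp ‖u‖) +
      gaussDens β (0 : E) * exp (-R) * exp (-‖u‖) := hBi.add (hI2.const_mul _)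
  have hφi : Integrable fun u => φ i u * ω u := by
    refine hBi'.mono' (hd.meas.mul hωm).aestronglyMeasurable (Eventually.of_forall fun u => ?_)
    rw [Real.norm_of_nonneg (mul_nonneg (hd.nonneg u) (hω0 u))]
    exact hb u
  refine ⟨hφi, (integral_mono hφi hBi' hb).trans ?_⟩
  rw [integral_add hBi (hI2.const_mul _), integral_add hGi (hI1.const_mul _), integral_const_mul,
    integral_const_mul]
  linarith

lemma TendstoGauss.exists_convPow_le (h : TendstoGauss l φ β) :
    ∃ S > 0, ∃ C ≥ 1, ∀ κ : ℝ, 0 < κ → κ ≤ 1 → ∀ᶠ i in l, ∀ m : ℕ, ∀ y,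
      convPow n (φ i) m y ≤ S * exp (C * κ ^ 2 * m - κ * ‖y‖) := by
  obtain ⟨S, hS, hSb⟩ := h.exists_sup_bound
  obtain ⟨C, hC, hCb⟩ := exists_gauss_laplace_bound (n := n) h.pos
  refine ⟨S, hS, C + 1, by linarith, fun κ hκ0 hκ1 => ?_⟩
  filter_upwards [h.dens, hSb, h.integral_mul_le (δ := κ ^ 2) (by positivity)] with i hd hs hi m y
  set w : E := (κ / ‖y‖) • y
  have hw : ‖w‖ ≤ κ := by
    rw [norm_smul, Real.norm_of_nonneg (by positivity)]
    rcases eq_or_ne ‖y‖ 0 with hy | hy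
    · simp [hy, hκ0.le]
    · rw [div_mul_cancel₀ _ hy]
  have hwy : ⟪w, y⟫ = κ * ‖y‖ := by
    rw [real_inner_smul_left, real_inner_self_eq_norm_sq]
    rcases eq_or_ne ‖y‖ 0 with hy | hy
    · simp [hy]
    · field_simp
  have hle : ∀ u : E, exp ⟪w, u⟫ ≤ exp ‖u‖ := fun u => by
    gcongr
    nlinarith [real_inner_le_norm w u, norm_nonneg u]
  obtain ⟨h1, h2⟩ := hi (fun u => exp ⟪w, u⟫) (by fun_prop) (fun u => (exp_pos _).le) hle
  obtain ⟨h3, h4⟩ := hCb w (hw.trans hκ1)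
  have h5 : ‖w‖ ^ 2 ≤ κ ^ 2 := by gcongr
  have h6 : ∫ u, φ i u * exp ⟪w, u⟫ ≤ exp ((C + 1) * κ ^ 2) := by
    have := add_one_le_exp ((C + 1) * κ ^ 2)
    nlinarith
  have h7 := convPow_le_exp hd.nonneg (innerSL ℝ w) hS.le (exp_pos ((C + 1) * κ ^ 2)).le
    (fun u => (mul_le_mul_of_nonneg_left (hle u) (hd.nonneg u)).trans (hs u)) h1 h6 m y
  refine h7.trans (le_of_eq ?_)
  rw [innerSL_apply_apply, hwy, ← exp_nat_mul, mul_assoc, ← exp_add]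
  ring_nf

omit [NeZero n] in
lemma convPow_neg {h : E → ℝ} (he : ∀ u, h (-u) = h u) (m : ℕ) (x : E) :
    convPow n h m (-x) = convPow n h m x := by
  induction m generalizing x with
  | zero => exact he x
  | succ m ih =>
    simp only [convPow]
    rw [← integral_neg_eq_self]
    refine integral_congr_ae (Eventually.of_forall fun y => ?_)
    simp only
    rw [he, show -x - -y = -(x - y) by abel, ih]

omit [NeZero n] in
lemma convPow_eq_zero {h : E → ℝ} {R : ℝ} (hs : ∀ u, R < ‖u‖ → h u = 0) (m : ℕ) (x : E)
    (hx : ((m : ℝ) + 1) * R < ‖x‖) : convPow n h m x = 0 := by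
  induction m generalizing x with
  | zero => exact hs x (by simpa using hx)
  | succ m ih =>
    simp only [convPow]
    refine integral_eq_zero_of_ae (Eventually.of_forall fun y => ?_)
    rcases le_or_gt ‖y‖ R with hy | hy
    · have : convPow n h m (x - y) = 0 := by
        refine ih _ ?_
        have := norm_sub_norm_le x y
        push_cast at hx
        linarith
      simp [this]
    · simp [hs y hy]

omit [NeZero n] in
/-- Lower bound at the origin for convolution powers of a symmetric log-concave function of
bounded support. -/
lemma convPow_zero_ge {h : E → ℝ} (hd : IsDensity h) (hl : LogConcaveFun h)
    (he : ∀ u, h (-u) = h u) {R : ℝ} (hR : 0 ≤ R) (hs : ∀ u, R < ‖u‖ → h u = 0) (m : ℕ) :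
    (∫ u, h u) ^ (m + 1) ≤
      (((m : ℝ) + 1) * R) ^ n * (volume (Metric.ball (0 : E) 1)).toReal * convPow n h m 0 := by
  have hmax : ∀ x, convPow n h m x ≤ convPow n h m 0 := by
    intro x
    have h1 := hl.convPow_logConcave hd m x (-x) (1 / 2) (1 / 2) (by norm_num) (by norm_num)
      (by norm_num)
    have h0 := convPow_nonneg hd.nonneg m x
    rwa [convPow_neg he, ← rpow_add_of_nonneg h0 (by norm_num) (by norm_num), smul_neg,
      add_neg_cancel, show (1 / 2 + 1 / 2 : ℝ) = 1 by norm_num, rpow_one] at h1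
  rw [← (hd.convPow_integrable m).2]
  set B := Metric.closedBall (0 : E) (((m : ℝ) + 1) * R)
  have hB : ∫ x, convPow n h m x = ∫ x in B, convPow n h m x := by
    refine (setIntegral_eq_integral_of_forall_compl_eq_zero fun x hx => ?_).symm
    refine convPow_eq_zero hs m x ?_
    simpa [B] using hx
  have hvol : volume.real B = (((m : ℝ) + 1) * R) ^ n * (volume (Metric.ball (0 : E) 1)).toReal := by
    rw [measureReal_def, Measure.addHaar_closedBall _ _ (by positivity), finrank_euclideanSpace_fin,
      ENNReal.toReal_mul, ENNReal.toReal_ofReal (by positivity)]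
  rw [hB, ← hvol]
  have hfin : volume B ≠ ∞ := (measure_closedBall_lt_top).ne
  calc ∫ x in B, convPow n h m x ≤ ∫ x in B, convPow n h m 0 :=
        setIntegral_mono (hd.convPow_integrable m).1.integrableOn
          (integrableOn_const hfin) hmax
    _ = _ := by rw [setIntegral_const, smul_eq_mul]

lemma gaussDens_logConcave (hβ : 0 < β) : LogConcaveFun (gaussDens β : E → ℝ) := by
  intro x y a b ha hb hab
  have hx := gaussDens_pos hβ x
  have hy := gaussDens_pos hβ y
  have hz := gaussDens_pos hβ (a • x + b • y)
  rw [← log_le_log_iff (by positivity) hz, log_mul (by positivity) (by positivity), log_rpow hx,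
    log_rpow hy, log_gaussDens hβ x, log_gaussDens hβ y, log_gaussDens hβ (a • x + b • y)]
  have := gaussQuad_convex hβ x y ha hb hab
  obtain rfl : b = 1 - a := by linarith
  linarith

omit [NeZero n] in
lemma LogConcaveFun.indicator {φ : E → ℝ} (h : LogConcaveFun φ) (h0 : ∀ x, 0 ≤ φ x) {s : Set E}
    (hs : Convex ℝ s) : LogConcaveFun (s.indicator φ) := by
  intro x y a b ha hb hab
  have hnn : 0 ≤ s.indicator φ (a • x + b • y) := indicator_nonneg (fun x _ => h0 x) _
  by_cases hx : x ∈ s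
  · by_cases hy : y ∈ s
    · rw [indicator_of_mem hx, indicator_of_mem hy,
        indicator_of_mem (hs hx hy ha.le hb.le hab)]
      exact h x y a b ha hb hab
    · rwa [indicator_of_notMem hy, zero_rpow hb.ne', mul_zero]
  · rwa [indicator_of_notMem hx, zero_rpow ha.ne', zero_mul]

lemma exists_le_integral_indicator (hβ : 0 < β) {η : ℝ} (hη : 0 < η) : ∃ R > 0,
    exp (-η) ≤ ∫ u, (Metric.closedBall (0 : E) R).indicator (gaussDens β) u := by
  have hI1 := gaussDens_integrable_exp (n := n) hβ
  have hI := gaussDens_integrable (n := n) hβ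
  set J := ∫ u : E, gaussDens β u * exp ‖u‖
  have t2 : Tendsto (fun R : ℝ => 1 - exp (-R) * J) atTop (𝓝 1) := by
    simpa using ((tendsto_exp_neg_atTop_nhds_zero).mul_const J).const_sub 1
  obtain ⟨R, hR1, hR2⟩ := ((t2.eventually (lt_mem_nhds
    (exp_lt_one_iff.2 (neg_neg_of_pos hη)))).and (eventually_gt_atTop 0)).exists
  refine ⟨R, hR2, hR1.le.trans ?_⟩
  have h1 : 1 - exp (-R) * J = ∫ u : E, (gaussDens β u - exp (-R) * (gaussDens β u * exp ‖u‖)) := by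
    rw [integral_sub hI (hI1.const_mul _), integral_gaussDens hβ, integral_const_mul]
  rw [h1]
  refine integral_mono (hI.sub (hI1.const_mul _)) (hI.indicator Metric.isClosed_closedBall.measurableSet)
    fun u => ?_
  have hp := gaussDens_pos hβ u
  have h2 : exp (-R) * (gaussDens β u * exp ‖u‖) = gaussDens β u * exp (‖u‖ - R) := by
    rw [sub_eq_add_neg, exp_add]; ring
  simp only
  rw [h2]
  by_cases hu : u ∈ Metric.closedBall (0 : E) R
  · rw [indicator_of_mem hu]
    have : 0 < gaussDens β u * exp (‖u‖ - R) := by positivity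
    linarith
  · rw [indicator_of_notMem hu]
    have : 1 ≤ exp (‖u‖ - R) := one_le_exp (by simp at hu; linarith)
    nlinarith

lemma TendstoGauss.exists_le_convPow (h : TendstoGauss l φ β) :
    ∃ Q > 0, ∀ η > 0, ∃ m₀ : ℕ, ∀ᶠ i in l, ∀ m ≥ m₀, ∀ y, ‖y‖ ≤ (m : ℝ) + 1 →
      exp (-η * ((m : ℝ) + 1) - Q * ‖y‖ ^ 2 / ((m : ℝ) + 1)) ≤ convPow n (φ i) m y := by
  obtain ⟨q, hq, q', hq', hQ⟩ := exists_gaussQuad_bounds (n := n) h.pos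
  refine ⟨q', hq', fun η hη => ?_⟩
  obtain ⟨R, hR, hRi⟩ := exists_le_integral_indicator (n := n) h.pos (η := η / 4) (by positivity)
  set k := (Metric.closedBall (0 : E) R).indicator (gaussDens β) with hk
  have hG : ∀ u : E, 0 ≤ gaussDens β u := fun u => (gaussDens_pos h.pos u).le
  have hk0 : ∀ u, 0 ≤ k u := fun u => indicator_nonneg (fun x _ => hG x) _
  have hkd : IsDensity k := by
    refine ⟨gaussDens_continuous.measurable.indicator Metric.isClosed_closedBall.measurableSet, hk0,
      (gaussDens_integrable h.pos).indicator Metric.isClosed_closedBall.measurableSet,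
      gaussDens β (0 : E), fun u => ?_⟩
    exact (indicator_le_self' (fun _ _ => hG _) u).trans (gaussDens_le h.pos u)
  have hkl : LogConcaveFun k := (gaussDens_logConcave h.pos).indicator hG (convex_closedBall _ _)
  have hke : ∀ u, k (-u) = k u := fun u => by
    simp only [hk, indicator, Metric.mem_closedBall, dist_zero_right, norm_neg, gaussDens_neg]
  have hks : ∀ u, R < ‖u‖ → k u = 0 := fun u hu => by
    rw [hk, indicator_of_notMem]; simpa using hu
  set V := (volume (Metric.ball (0 : E) 1)).toReal
  have t : Tendsto (fun m : ℕ => (R ^ n * V) * (((m : ℝ) + 1) ^ n * exp (-(η / 2) * ((m : ℝ) + 1))))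
      atTop (𝓝 0) := by
    have t1 : Tendsto (fun m : ℕ => (m : ℝ) + 1) atTop atTop :=
      tendsto_atTop_add_const_right _ _ tendsto_natCast_atTop_atTop
    have t2 := (tendsto_rpow_mul_exp_neg_mul_atTop_nhds_zero (n : ℝ) (η / 2) (by positivity)).comp t1
    simpa using t2.const_mul (R ^ n * V)
  obtain ⟨m₀, hm₀⟩ := eventually_atTop.1 (t.eventually (gt_mem_nhds one_pos))
  refine ⟨m₀, ?_⟩
  filter_upwards [h.dens, h.close (R + 1) (η / 4) (by positivity)] with i hd hc m hm y hy
  set M := (m : ℝ) + 1 with hM_def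
  have hM : 0 < M := by positivity
  set b : E := M⁻¹ • y
  have hbn : ‖b‖ = ‖y‖ / M := by
    rw [norm_smul, Real.norm_of_nonneg (by positivity)]; ring
  have hb1 : ‖b‖ ≤ 1 := by rw [hbn]; exact (div_le_one hM).2 hy
  obtain ⟨L, hL⟩ := exists_gaussQuad_add β b
  set A := exp (-(η / 4) - gaussQuad β b) with hA
  set p : E → ℝ := fun v => A * exp ((-L) (v - b)) * k (v - b)
  have hp0 : ∀ v, 0 ≤ p v := fun v => mul_nonneg (by positivity) (hk0 _)
  have hpφ : ∀ v, p v ≤ φ i v := by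
    intro v
    by_cases hv : v - b ∈ Metric.closedBall (0 : E) R
    · have hvR : ‖v - b‖ ≤ R := by simpa using hv
      have hvn : ‖v‖ ≤ R + 1 := by
        have := norm_add_le (v - b) b
        rw [sub_add_cancel] at this
        linarith
      refine le_trans (le_of_eq ?_) (hc v hvn).1
      have e : gaussQuad β v = gaussQuad β b + L (v - b) + gaussQuad β (v - b) := by
        rw [← hL, add_sub_cancel]
      simp only [p, hk, indicator_of_mem hv, gaussDens, e, hA, neg_apply]
      have e2 : exp (-(gaussQuad β b + L (v - b) + gaussQuad β (v - b))) =
          exp (- gaussQuad β b) * exp (-L (v - b)) * exp (-gaussQuad β (v - b)) := by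
        rw [← exp_add, ← exp_add]; ring_nf
      rw [e2, sub_eq_add_neg, exp_add]
      ring
    · simp only [p, hk, indicator_of_notMem hv, mul_zero]
      exact hd.nonneg v
  have h1 := convPow_affine (n := n) (p := p) (φ := k) (b := b) (A := A) one_pos (-L)
    (fun u => by simp [p]) m 0
  rw [smul_zero, add_zero, smul_inv_smul₀ hM.ne'] at h1
  simp only [one_pow, one_mul, map_zero, exp_zero, mul_one] at h1
  have h2 := convPow_mono hp0 hd hpφ m y
  rw [h1] at h2
  refine le_trans ?_ h2
  have h3 := convPow_zero_ge hkd hkl hke hR.le hks m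
  have h4 : exp (-(η / 4)) ^ (m + 1) ≤ (∫ u, k u) ^ (m + 1) := by gcongr
  have h5 := hm₀ m hm
  have hc0 := convPow_nonneg hk0 m 0
  have h6 : exp (-(3 * η / 4) * M) ≤ convPow n k m 0 := by
    have e1 : exp (-(η / 4)) ^ (m + 1) = exp (-(η / 4) * M) := by
      rw [← exp_nat_mul, hM_def]; push_cast; ring_nf
    have e2 : exp (-(3 * η / 4) * M) = exp (-(η / 4) * M) * exp (-(η / 2) * M) := by
      rw [← exp_add]; ring_nf
    rw [e2]
    calc exp (-(η / 4) * M) * exp (-(η / 2) * M)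
        ≤ ((M * R) ^ n * V * convPow n k m 0) * exp (-(η / 2) * M) := by
          gcongr; rw [← e1]; exact h4.trans h3
      _ = ((R ^ n * V) * (M ^ n * exp (-(η / 2) * M))) * convPow n k m 0 := by
          rw [mul_pow]; ring
      _ ≤ 1 * convPow n k m 0 := by gcongr
      _ = _ := one_mul _
  have h7 : A ^ (m + 1) = exp (-(η / 4) * M - gaussQuad β b * M) := by
    rw [hA, ← exp_nat_mul, hM_def]; push_cast; ring_nf
  have h8 : gaussQuad β b * M ≤ q' * ‖y‖ ^ 2 / M := by
    have := (hQ b).2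
    calc gaussQuad β b * M ≤ q' * ‖b‖ ^ 2 * M := by gcongr
      _ = _ := by rw [hbn]; field_simp
  calc _ ≤ exp (-(η / 4) * M - gaussQuad β b * M) * exp (-(3 * η / 4) * M) := by
        rw [← exp_add]; gcongr; linarith
    _ ≤ _ := by rw [h7]; gcongr

end Family

/-- A log-concave function which does not drop much on the ball of radius `R` around `y₀` grows
at most exponentially away from `y₀`. -/
lemma LogConcaveFun.le_mul_exp {V : Type*} [NormedAddCommGroup V] [NormedSpace ℝ V] {L : V → ℝ}
    (hl : LogConcaveFun L) (h0 : ∀ y, 0 ≤ L y) {y₀ : V} {R c : ℝ} (hR : 0 < R)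
    (h : ∀ y, ‖y - y₀‖ ≤ R → 0 < L y ∧ log (L y₀) - log (L y) ≤ c * R) (y₁ : V) :
    L y₁ ≤ L y₀ * exp (c * ‖y₁ - y₀‖) := by
  have hy0 := (h y₀ (by simpa using hR.le)).1
  rcases eq_or_ne y₁ y₀ with rfl | hne
  · simp
  rcases (h0 y₁).eq_or_lt with h1 | h1
  · rw [← h1]; positivity
  have hd : 0 < ‖y₁ - y₀‖ := norm_pos_iff.2 (sub_ne_zero.2 hne)
  set d := ‖y₁ - y₀‖
  set y₂ : V := y₀ - (R / d) • (y₁ - y₀) with hy₂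
  have hy2 : ‖y₂ - y₀‖ ≤ R := by
    rw [hy₂, sub_sub_cancel_left, norm_neg, norm_smul, Real.norm_of_nonneg (by positivity),
      div_mul_cancel₀ _ hd.ne']
  obtain ⟨hp, hlog⟩ := h y₂ hy2
  have key := hl.le_log h1 hp (a := R / (R + d)) (b := d / (R + d)) (by positivity)
    (by positivity) (by field_simp)
  have e : (R / (R + d)) • y₁ + (d / (R + d)) • y₂ = y₀ := by
    have h1 : (R / (R + d)) • y₁ + (d / (R + d)) • y₂ =
        (R / (R + d) - d / (R + d) * (R / d)) • y₁ + (d / (R + d) + d / (R + d) * (R / d)) • y₀ := by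
      rw [hy₂]; module
    have h2 : R / (R + d) - d / (R + d) * (R / d) = 0 := by field_simp; ring
    have h3 : d / (R + d) + d / (R + d) * (R / d) = 1 := by field_simp; ring
    rw [h1, h2, h3, zero_smul, one_smul, zero_add]
  rw [e] at key
  have key2 : R * log (L y₁) + d * log (L y₂) ≤ (R + d) * log (L y₀) := by
    have := mul_le_mul_of_nonneg_left key (show 0 ≤ R + d by positivity)
    refine le_trans (le_of_eq ?_) this
    field_simp
  have key3 : log (L y₁) ≤ log (L y₀) + c * d := by
    have : R * log (L y₁) ≤ R * (log (L y₀) + c * d) := by nlinarith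
    exact le_of_mul_le_mul_left this hR
  calc L y₁ = exp (log (L y₁)) := (exp_log h1).symm
    _ ≤ exp (log (L y₀) + c * d) := exp_le_exp.2 key3
    _ = _ := by rw [exp_add, exp_log hy0]

lemma exp_mul_factorial_le (m : ℕ) :
    exp m * (Nat.factorial (m + 1) : ℝ) ≤ ((m : ℝ) + 1) ^ (m + 2) := by
  induction m with
  | zero => simp
  | succ m ih =>
    have h1 : exp 1 * ((m : ℝ) + 1) ^ (m + 2) ≤ ((m : ℝ) + 2) ^ (m + 2) := by
      have h2 : 1 ≤ (m + 2 : ℕ) * log (((m : ℝ) + 2) / (m + 1)) := by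
        have := one_sub_inv_le_log_of_pos (x := ((m : ℝ) + 2) / (m + 1)) (by positivity)
        calc (1 : ℝ) = (m + 2 : ℕ) * (1 - (((m : ℝ) + 2) / (m + 1))⁻¹) := by
              push_cast; field_simp; ring
          _ ≤ _ := by gcongr
      have h3 := exp_le_exp.2 h2
      rw [exp_nat_mul, exp_log (by positivity), div_pow, le_div_iff₀ (by positivity)] at h3
      exact h3
    rw [Nat.factorial_succ]
    push_cast
    rw [exp_add]
    calc exp m * exp 1 * (((m : ℝ) + 1 + 1) * (Nat.factorial (m + 1) : ℝ))
        = (exp m * (Nat.factorial (m + 1) : ℝ)) * exp 1 * ((m : ℝ) + 2) := by ring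
      _ ≤ ((m : ℝ) + 1) ^ (m + 2) * exp 1 * ((m : ℝ) + 2) := by gcongr
      _ = (exp 1 * ((m : ℝ) + 1) ^ (m + 2)) * ((m : ℝ) + 2) := by ring
      _ ≤ ((m : ℝ) + 2) ^ (m + 2) * ((m : ℝ) + 2) := by gcongr
      _ = ((m : ℝ) + 1 + 1) ^ (m + 1 + 2) := by ring

section Family

variable {n : ℕ} [NeZero n] {ι : Type*} {l : Filter ι} {φ : ι → EuclideanSpace ℝ (Fin n) → ℝ}
  {β : ℝ}

/-- Comparison of consecutive convolution powers near the origin. -/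
lemma TendstoGauss.exists_jump_bound (h : TendstoGauss l φ β) {δ K : ℝ} (hδ : 0 < δ)
    (hδ1 : δ < 1) :
    ∃ κ > 0, κ ≤ 1 ∧ ∃ m₀ : ℕ, ∀ᶠ i in l, ∀ m ≥ m₀, ∀ v u, ‖v‖ ≤ κ * ((m : ℝ) + 1) → ‖u‖ ≤ K →
      0 < convPow n (φ i) (m + 1) v ∧
        (1 - δ) * gaussDens β u * convPow n (φ i) (m + 1) v ≤
          φ i u * convPow n (φ i) m (v - u) := by
  obtain ⟨S, hS, C, hC, hU⟩ := h.exists_convPow_le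
  obtain ⟨Q, hQ, hL⟩ := h.exists_le_convPow
  set c₀ := C + 2 + 9 * Q
  have hc₀ : 3 ≤ c₀ := by linarith
  have t : Tendsto (fun k : ℝ => (1 - δ) * exp k * (exp (k * K) * (gaussMoment n β k + k)))
      (𝓝[>] 0) (𝓝 (1 - δ)) := by
    have t0 : Tendsto (fun k : ℝ => k) (𝓝[>] 0) (𝓝 0) := nhdsWithin_le_nhds
    have t1 := (Real.continuous_exp.tendsto 0).comp t0
    have t2 := (Real.continuous_exp.tendsto (0 * K)).comp (t0.mul_const K)
    have t3 := (t1.const_mul (1 - δ)).mul (t2.mul ((gaussMoment_tendsto (n := n) h.pos).add t0))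
    simpa using t3
  obtain ⟨k, ⟨hk1, hk2⟩, hk0⟩ := (((t.eventually (gt_mem_nhds (show 1 - δ < 1 by linarith))).and
    (mem_nhdsWithin_of_mem_nhds (Iio_mem_nhds one_pos))).and (eventually_mem_nhdsWithin)).exists
  rw [mem_Ioi] at hk0
  set κ := k / c₀ with hκ
  have hκ0 : 0 < κ := by positivity
  have hκ3 : κ ≤ 1 / 3 := by
    rw [hκ, div_le_div_iff₀ (by positivity) (by norm_num)]; linarith
  have hck : c₀ * κ = k := by rw [hκ]; field_simp
  obtain ⟨m₁, hm₁⟩ := hL (κ ^ 2) (by positivity)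
  have tm : Tendsto (fun m : ℕ => (m : ℝ) + 1) atTop atTop :=
    tendsto_atTop_add_const_right _ _ tendsto_natCast_atTop_atTop
  obtain ⟨m₂, hm₂⟩ := eventually_atTop.1 ((tm.eventually_ge_atTop (log S / κ ^ 2)).and
    (tm.eventually_ge_atTop (K / κ)))
  refine ⟨κ, hκ0, by linarith, max m₁ m₂, ?_⟩
  filter_upwards [h.dens, h.logConcave, hU κ hκ0 (by linarith), hm₁,
    h.integral_mul_le hk0, h.close K k hk0] with i hd hl hup hlo hInt hcl m hm v u hv hu
  set M := (m : ℝ) + 1 with hM_def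
  have hM : 0 < M := by positivity
  obtain ⟨hMS, hMK⟩ := hm₂ m ((le_max_right _ _).trans hm)
  rw [← hM_def, div_le_iff₀ (by positivity)] at hMS hMK
  have hm1 : m₁ ≤ m := (le_max_left _ _).trans hm
  have hvM : ‖v‖ ≤ M := hv.trans (by nlinarith)
  have hpos : 0 < convPow n (φ i) (m + 1) v :=
    lt_of_lt_of_le (exp_pos _) (hlo (m + 1) (by omega) v (by push_cast; linarith))
  refine ⟨hpos, ?_⟩
  set L := convPow n (φ i) m with hL_def
  have hL0 : ∀ y, 0 ≤ L y := convPow_nonneg hd.nonneg m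
  have hslope : ∀ y, ‖y - (v - u)‖ ≤ κ * M →
      0 < L y ∧ log (L (v - u)) - log (L y) ≤ k * (κ * M) := by
    intro y hy
    have hy3 : ‖y‖ ≤ 3 * κ * M := by
      calc ‖y‖ = ‖(y - (v - u)) + (v - u)‖ := by rw [sub_add_cancel]
        _ ≤ ‖y - (v - u)‖ + (‖v‖ + ‖u‖) := (norm_add_le _ _).trans (by gcongr; exact norm_sub_le _ _)
        _ ≤ _ := by linarith
    have hlow := hlo m hm1 y (hy3.trans (by nlinarith))
    have hLy : 0 < L y := lt_of_lt_of_le (exp_pos _) hlow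
    refine ⟨hLy, ?_⟩
    have h1 : -κ ^ 2 * M - Q * (3 * κ * M) ^ 2 / M ≤ log (L y) := by
      rw [le_log_iff_exp_le hLy]
      refine le_trans (exp_le_exp.2 ?_) hlow
      rw [← hM_def]
      gcongr
    have h2 : Q * (3 * κ * M) ^ 2 / M = 9 * Q * κ ^ 2 * M := by field_simp; ring
    have h3 : log (L (v - u)) ≤ log S + C * κ ^ 2 * M := by
      have hvu : 0 < L (v - u) := by
        refine lt_of_lt_of_le (exp_pos _) (hlo m hm1 (v - u) ?_)
        calc ‖v - u‖ ≤ ‖v‖ + ‖u‖ := norm_sub_le _ _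
          _ ≤ κ * M + K := by gcongr
          _ ≤ M := by nlinarith
      rw [log_le_iff_le_exp hvu, exp_add, exp_log hS]
      refine (hup m (v - u)).trans ?_
      gcongr
      have : C * κ ^ 2 * m ≤ C * κ ^ 2 * M := by gcongr; linarith
      have : 0 ≤ κ * ‖v - u‖ := by positivity
      linarith
    have h4 : k * (κ * M) = (C + 2 + 9 * Q) * κ ^ 2 * M := by
      rw [← hck]; ring
    rw [h4]
    linarith
  have hgrow := (hl.convPow_logConcave hd m).le_mul_exp hL0 (y₀ := v - u) (R := κ * M)
    (by positivity) hslope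
  obtain ⟨hi1, hi2⟩ := hInt (fun w => exp (k * ‖w‖)) (by fun_prop) (fun w => (exp_pos _).le)
    (fun w => exp_le_exp.2 (by nlinarith [norm_nonneg w]))
  have hbig : convPow n (φ i) (m + 1) v ≤
      L (v - u) * exp (k * K) * (gaussMoment n β k + k) := by
    have h1 : convPow n (φ i) (m + 1) v ≤
        ∫ w, L (v - u) * exp (k * K) * (φ i w * exp (k * ‖w‖)) := by
      refine integral_mono (hd.convPow_integrand m v) (hi1.const_mul _) fun w => ?_
      calc L (v - w) * φ i w ≤ (L (v - u) * exp (k * ‖(v - w) - (v - u)‖)) * φ i w :=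
            mul_le_mul_of_nonneg_right (hgrow (v - w)) (hd.nonneg w)
        _ ≤ (L (v - u) * exp (k * K + k * ‖w‖)) * φ i w := by
            have h5 := hL0 (v - u)
            have h6 := hd.nonneg w
            gcongr
            rw [sub_sub_sub_cancel_left, ← mul_add]
            gcongr
            exact (norm_sub_le _ _).trans (by gcongr)
        _ = _ := by rw [exp_add]; ring
    rw [integral_const_mul] at h1
    refine h1.trans ?_
    have h5 := hL0 (v - u)
    gcongr
    exact hi2
  have hGu := gaussDens_pos h.pos u
  have h5 := hL0 (v - u)
  have hφu := (hcl u hu).1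
  calc (1 - δ) * gaussDens β u * convPow n (φ i) (m + 1) v
      ≤ (1 - δ) * gaussDens β u * (L (v - u) * exp (k * K) * (gaussMoment n β k + k)) := by
        gcongr
    _ = ((1 - δ) * exp k * (exp (k * K) * (gaussMoment n β k + k))) *
          (exp (-k) * gaussDens β u * L (v - u)) := by
        rw [exp_neg]; field_simp
    _ ≤ 1 * (φ i u * L (v - u)) := by gcongr
    _ = _ := one_mul _

/-- Unnormalised weight of the `m + 1` jump configurations in rescaled coordinates. -/
def jumpWeight (φ : EuclideanSpace ℝ (Fin n) → ℝ) (N a : ℝ) (e : EuclideanSpace ℝ (Fin n))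
    (m : ℕ) : ℝ :=
  N ^ (m + 1) / (Nat.factorial (m + 1) : ℝ) * convPow n φ m (((N - ((m : ℝ) + 1)) * a) • e)

omit [NeZero n] in
lemma jumpWeight_nonneg {φ : EuclideanSpace ℝ (Fin n) → ℝ} (h0 : ∀ x, 0 ≤ φ x) {N : ℝ} (hN : 0 ≤ N)
    (a : ℝ) (e : EuclideanSpace ℝ (Fin n)) (m : ℕ) : 0 ≤ jumpWeight φ N a e m :=
  mul_nonneg (by positivity) (convPow_nonneg h0 _ _)

set_option maxHeartbeats 1000000 in
/-- The number of jumps concentrates around `N`. -/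
lemma TendstoGauss.jumpWeight_window (h : TendstoGauss l φ β) {N a : ι → ℝ}
    (hN : Tendsto N l atTop) (ha : ∀ᶠ i in l, 0 < a i)
    (haN : Tendsto (fun i => a i / N i) l (𝓝 0)) {e : EuclideanSpace ℝ (Fin n)} (he : ‖e‖ = 1)
    {κ δ : ℝ} (hκ : 0 < κ) (hκ1 : κ ≤ 1) (hδ : 0 < δ) :
    ∀ᶠ i in l, Summable (jumpWeight (φ i) (N i) (a i) e) ∧
      0 < ∑' m, jumpWeight (φ i) (N i) (a i) e m ∧
      ∑' m : ℕ, {m : ℕ | κ * N i < |N i - ((m : ℝ) + 1)| * a i}.indicator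
        (jumpWeight (φ i) (N i) (a i) e) m ≤ δ * ∑' m, jumpWeight (φ i) (N i) (a i) e m := by
  obtain ⟨S, hS, C, hC, hU⟩ := h.exists_convPow_le
  obtain ⟨Q, hQ, hL⟩ := h.exists_le_convPow
  set κ' := κ / (4 * C) with hκ'
  have hκ'0 : 0 < κ' := by positivity
  have hκ'κ : 4 * C * κ' = κ := by rw [hκ']; field_simp
  have hκ'1 : κ' ≤ 1 / 4 := by nlinarith
  set τ := C * κ' ^ 2 with hτ
  have hτ0 : 0 < τ := by positivity
  have hτκ : κ' * κ = 4 * τ := by rw [hτ, ← hκ'κ]; ring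
  have hτ1 : τ ≤ 1 / 4 := by nlinarith
  have hexpτ : exp τ ≤ 1 + 2 * τ := by
    have := Real.exp_bound_div_one_sub_of_interval hτ0.le (by linarith : τ < 1)
    refine this.trans ?_
    rw [div_le_iff₀ (by linarith)]
    nlinarith
  obtain ⟨m₁, hm₁⟩ := hL (τ / 2) (by positivity)
  set σ := min (1 / 2) (√(τ / (4 * Q))) with hσ
  have hσ0 : 0 < σ := by positivity
  have hσ2 : Q * σ ^ 2 ≤ τ / 4 := by
    have : σ ^ 2 ≤ τ / (4 * Q) := by
      calc σ ^ 2 ≤ √(τ / (4 * Q)) ^ 2 := by gcongr; exact min_le_right _ _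
        _ = _ := sq_sqrt (by positivity)
    calc Q * σ ^ 2 ≤ Q * (τ / (4 * Q)) := by gcongr
      _ = _ := by field_simp
  have t : Tendsto (fun x : ℝ => (S * exp 2) * (x * exp (-τ * x))) atTop (𝓝 0) := by
    have := tendsto_rpow_mul_exp_neg_mul_atTop_nhds_zero 1 τ hτ0
    simpa using this.const_mul (S * exp 2)
  filter_upwards [h.dens, hU κ' hκ'0 (by linarith), hm₁, ha, hN.eventually_ge_atTop 2,
    hN.eventually_ge_atTop ((m₁ : ℝ) + 3), haN.eventually (gt_mem_nhds hσ0),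
    hN.eventually (t.eventually (gt_mem_nhds hδ))]
    with i hd hup hlo hapos hN2 hNm haσ hfin
  set x := N i
  set b := a i
  set W := jumpWeight (φ i) x b e
  have hx0 : 0 < x := by linarith
  have hW0 : ∀ m, 0 ≤ W m := jumpWeight_nonneg hd.nonneg hx0.le b e
  have hWle : ∀ m : ℕ, W m ≤ S * exp (-(κ' * (|x - ((m : ℝ) + 1)| * b))) *
      ((x * exp τ) ^ (m + 1) / (Nat.factorial (m + 1) : ℝ)) := by
    intro m
    have h1 := hup m (((x - ((m : ℝ) + 1)) * b) • e)
    rw [norm_smul, he, mul_one, norm_mul, Real.norm_eq_abs, Real.norm_of_nonneg hapos.le] at h1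
    have h2 : exp (C * κ' ^ 2 * m - κ' * (|x - ((m : ℝ) + 1)| * b)) ≤
        exp τ ^ (m + 1) * exp (-(κ' * (|x - ((m : ℝ) + 1)| * b))) := by
      rw [← exp_nat_mul, ← exp_add]
      gcongr
      push_cast
      linarith
    calc W m ≤ x ^ (m + 1) / (Nat.factorial (m + 1) : ℝ) *
          (S * (exp τ ^ (m + 1) * exp (-(κ' * (|x - ((m : ℝ) + 1)| * b))))) := by
          refine mul_le_mul_of_nonneg_left (h1.trans ?_) (by positivity)
          gcongr
      _ = _ := by rw [mul_pow]; ring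
  have hs0 : Summable fun m : ℕ => (x * exp τ) ^ (m + 1) / (Nat.factorial (m + 1) : ℝ) :=
    (summable_nat_add_iff 1).2 (Real.summable_pow_div_factorial (x * exp τ))
  have hsum : ∑' m : ℕ, (x * exp τ) ^ (m + 1) / (Nat.factorial (m + 1) : ℝ) ≤
      exp (x * exp τ) := by
    have h1 := (Real.summable_pow_div_factorial (x * exp τ)).sum_add_tsum_nat_add 1
    have h2 : exp (x * exp τ) = ∑' k : ℕ, (x * exp τ) ^ k / (Nat.factorial k : ℝ) := by
      rw [Real.exp_eq_exp_ℝ, NormedSpace.exp_eq_tsum_div]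
    rw [h2, ← h1]
    simp
  have hWs : Summable W := by
    refine Summable.of_nonneg_of_le hW0 (fun m => (hWle m).trans ?_) (hs0.mul_left S)
    have : exp (-(κ' * (|x - ((m : ℝ) + 1)| * b))) ≤ 1 := by
      rw [exp_le_one_iff, neg_nonpos]; positivity
    calc _ ≤ S * 1 * ((x * exp τ) ^ (m + 1) / (Nat.factorial (m + 1) : ℝ)) := by gcongr
      _ = _ := by rw [mul_one]
  have htail : ∑' m : ℕ, {m : ℕ | κ * x < |x - ((m : ℝ) + 1)| * b}.indicator W m ≤
      S * exp (x * (1 - 2 * τ)) := by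
    have h1 : ∀ m, {m : ℕ | κ * x < |x - ((m : ℝ) + 1)| * b}.indicator W m ≤
        S * exp (-(4 * τ * x)) * ((x * exp τ) ^ (m + 1) / (Nat.factorial (m + 1) : ℝ)) := by
      intro m
      by_cases hm : m ∈ {m : ℕ | κ * x < |x - ((m : ℝ) + 1)| * b}
      · rw [indicator_of_mem hm]
        have hm' : κ * x < |x - ((m : ℝ) + 1)| * b := hm
        refine (hWle m).trans ?_
        have h4 : 4 * τ * x ≤ κ' * (|x - ((m : ℝ) + 1)| * b) := by
          rw [← hτκ, mul_assoc]
          gcongr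
        have h5 := exp_le_exp.2 (neg_le_neg h4)
        gcongr ?_ * _
        exact mul_le_mul_of_nonneg_left h5 hS.le
      · rw [indicator_of_notMem hm]
        positivity
    calc _ ≤ ∑' m : ℕ, S * exp (-(4 * τ * x)) *
          ((x * exp τ) ^ (m + 1) / (Nat.factorial (m + 1) : ℝ)) :=
          (hWs.indicator _).tsum_le_tsum h1 (hs0.mul_left _)
      _ ≤ S * exp (-(4 * τ * x)) * exp (x * (1 + 2 * τ)) := by
          rw [tsum_mul_left]
          gcongr
          exact hsum.trans (exp_le_exp.2 (by gcongr))
      _ = _ := by rw [mul_assoc, ← exp_add]; ring_nf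
  -- lower bound from the term closest to `x`
  set m := ⌊x⌋₊ - 1 with hm
  have hfl : 1 ≤ ⌊x⌋₊ := Nat.le_floor (by push_cast; linarith)
  have hmM : ((m : ℝ) + 1) = (⌊x⌋₊ : ℝ) := by
    rw [hm, Nat.cast_sub hfl]; push_cast; ring
  have hMx : (m : ℝ) + 1 ≤ x := hmM ▸ Nat.floor_le hx0.le
  have hxM : x < (m : ℝ) + 2 := by have := Nat.lt_floor_add_one x; linarith
  have hmm : m₁ ≤ m := by
    have : (m₁ : ℝ) < m := by linarith
    exact_mod_cast this.le
  have hbx : b ≤ σ * x := by rw [div_lt_iff₀ hx0] at haσ; exact haσ.le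
  have hσh : σ ≤ 1 / 2 := min_le_left _ _
  have hyb : ‖((x - ((m : ℝ) + 1)) * b) • e‖ ≤ σ * x := by
    rw [norm_smul, he, mul_one, norm_mul, Real.norm_of_nonneg (by linarith),
      Real.norm_of_nonneg hapos.le]
    nlinarith
  have hMhalf : x / 2 ≤ (m : ℝ) + 1 := by linarith
  have hlow := hlo m hmm _ (hyb.trans (by nlinarith))
  have hlow2 : exp (-τ * x) ≤ convPow n (φ i) m (((x - ((m : ℝ) + 1)) * b) • e) := by
    refine le_trans (exp_le_exp.2 ?_) hlow
    have h1 : Q * ‖((x - ((m : ℝ) + 1)) * b) • e‖ ^ 2 / ((m : ℝ) + 1) ≤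
        Q * (σ * x) ^ 2 / (x / 2) := by gcongr
    have h2 : Q * (σ * x) ^ 2 / (x / 2) = (Q * σ ^ 2) * (2 * x) := by field_simp
    have h3 : (Q * σ ^ 2) * (2 * x) ≤ τ / 4 * (2 * x) := by gcongr
    have h4 : τ / 2 * ((m : ℝ) + 1) ≤ τ / 2 * x := by gcongr
    linarith
  have hWlow : exp (x - 2) / x * exp (-τ * x) ≤ W m := by
    refine mul_le_mul ?_ hlow2 (exp_pos _).le (by positivity)
    rw [div_le_div_iff₀ hx0 (by positivity)]
    calc exp (x - 2) * (Nat.factorial (m + 1) : ℝ) ≤ exp m * (Nat.factorial (m + 1) : ℝ) := by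
          gcongr; linarith
      _ ≤ ((m : ℝ) + 1) ^ (m + 2) := exp_mul_factorial_le m
      _ ≤ x ^ (m + 2) := by gcongr
      _ = _ := by ring
  have hWsum : exp (x - 2) / x * exp (-τ * x) ≤ ∑' m, W m :=
    hWlow.trans (hWs.le_tsum m fun j _ => hW0 j)
  refine ⟨hWs, lt_of_lt_of_le (by positivity) hWsum, htail.trans ?_⟩
  refine le_trans ?_ (mul_le_mul_of_nonneg_left hWsum hδ.le)
  have e1 : exp (x * (1 - 2 * τ)) = (exp 2 * x * exp (-τ * x)) * (exp (x - 2) / x * exp (-τ * x)) := by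
    rw [show x * (1 - 2 * τ) = 2 + -τ * x + (x - 2) + -τ * x by ring, exp_add, exp_add, exp_add]
    field_simp
  rw [e1]
  calc _ = (S * exp 2 * (x * exp (-τ * x))) * (exp (x - 2) / x * exp (-τ * x)) := by ring
    _ ≤ _ := by gcongr

end Family

section RegularVariation

variable {α : ℝ} {f : ℝ → ℝ}

lemma SmoothRegVary.eventually_hasDerivAt (hf : SmoothRegVary α f) :
    ∀ᶠ z in atTop, ∀ x ≥ z, 0 < f x ∧ HasDerivAt f (deriv f x) x ∧
      HasDerivAt (deriv f) (deriv (deriv f) x) x := by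
  obtain ⟨z₀, hz₀, hpos, hcd, -, -⟩ := hf
  filter_upwards [eventually_gt_atTop z₀] with z hz x hx
  have hx' : z₀ < x := hz.trans_le hx
  refine ⟨hpos x hx', ?_, ?_⟩
  · exact ((hcd.differentiableOn (by simp)).differentiableAt (Ioi_mem_nhds hx')).hasDerivAt
  · have h2 : ContDiffOn ℝ (1 : ℕ∞) (deriv f) (Ioi z₀) :=
      hcd.deriv_of_isOpen isOpen_Ioi (by norm_cast)
    exact ((h2.differentiableOn (by simp)).differentiableAt (Ioi_mem_nhds hx')).hasDerivAt

lemma SmoothRegVary.eventually_hasDerivAt_log (hf : SmoothRegVary α f) :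
    ∀ᶠ u in atTop, HasDerivAt (fun u => log (f (exp u))) (exp u * deriv f (exp u) / f (exp u)) u := by
  have h := tendsto_exp_atTop.eventually hf.eventually_hasDerivAt
  filter_upwards [h] with u hu
  obtain ⟨h1, h2, -⟩ := hu _ le_rfl
  rw [mul_comm (exp u)]
  exact (h2.comp u (Real.hasDerivAt_exp u)).log h1.ne'

lemma SmoothRegVary.tendsto_deriv (hf : SmoothRegVary α f) :
    Tendsto (fun x => x * deriv f x / f x) atTop (𝓝 α) := by
  obtain ⟨z₀, hz₀, hpos, hcd, hd, -⟩ := id hf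
  have h := hd.comp tendsto_log_atTop
  refine h.congr' ?_
  filter_upwards [tendsto_log_atTop.eventually hf.eventually_hasDerivAt_log,
    eventually_gt_atTop 0] with x hx hx0
  rw [Function.comp_apply, hx.deriv, exp_log hx0]

lemma SmoothRegVary.tendsto_deriv_deriv (hf : SmoothRegVary α f) :
    Tendsto (fun x => x ^ 2 * deriv (deriv f) x / f x) atTop (𝓝 (α * (α - 1))) := by
  obtain ⟨z₀, hz₀, hpos, hcd, -, hdd⟩ := id hf
  have h2 := (hdd 2 le_rfl).comp tendsto_log_atTop
  have h3 : Tendsto (fun x => iteratedDeriv 2 (fun u => log (f (exp u))) (log x)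
      + (x * deriv f x / f x) ^ 2 - x * deriv f x / f x) atTop (𝓝 (0 + α ^ 2 - α)) :=
    (h2.add (hf.tendsto_deriv.pow 2)).sub hf.tendsto_deriv
  rw [show α * (α - 1) = 0 + α ^ 2 - α by ring]
  refine h3.congr' ?_
  obtain ⟨U, hU⟩ := eventually_atTop.1 hf.eventually_hasDerivAt_log
  filter_upwards [tendsto_log_atTop.eventually_gt_atTop U,
    eventually_gt_atTop 0, hf.eventually_hasDerivAt] with x hxU hx0 hxd
  have hx := (eventually_gt_nhds hxU).mono fun u hu => hU u hu.le
  obtain ⟨hfx, h1, h2⟩ := hxd x le_rfl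
  have e1 : deriv (fun u => log (f (exp u))) =ᶠ[𝓝 (log x)]
      fun u => exp u * deriv f (exp u) / f (exp u) := hx.mono fun u hu => hu.deriv
  have key : HasDerivAt (fun u => exp u * deriv f (exp u) / f (exp u)) 
      (((x * deriv f x + x * (deriv (deriv f) x * x)) * f x - x * deriv f x * (deriv f x * x))
        / f x ^ 2) (log x) := by
    have a1 := Real.hasDerivAt_exp (log x)
    rw [exp_log hx0] at a1
    have a2 : HasDerivAt (fun u => f (exp u)) (deriv f x * x) (log x) := by
      refine HasDerivAt.comp (log x) (h₂ := f) ?_ a1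
      rwa [exp_log hx0]
    have a3 : HasDerivAt (fun u => deriv f (exp u)) (deriv (deriv f) x * x) (log x) := by
      refine HasDerivAt.comp (log x) (h₂ := deriv f) ?_ a1
      rwa [exp_log hx0]
    have := (a1.mul a3).div a2 (by rw [exp_log hx0]; exact hfx.ne')
    simp only [Pi.mul_apply, exp_log hx0] at this
    exact this
  rw [iteratedDeriv_succ, iteratedDeriv_one, e1.deriv_eq, key.deriv]
  field_simp
  ring

/-- A smoothly regularly varying function is slowly oscillating on multiplicative scale. -/
lemma SmoothRegVary.tendsto_ratio (hf : SmoothRegVary α f) {ι : Type*} {l : Filter ι} {c ξ : ι → ℝ}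
    (hc : Tendsto c l atTop) (hξ : Tendsto (fun i => ξ i / c i) l (𝓝 1)) :
    Tendsto (fun i => f (ξ i) / f (c i)) l (𝓝 1) := by
  obtain ⟨z₀, hz₀, hpos, hcd, hd, -⟩ := id hf
  have hξt : Tendsto ξ l atTop := by
    refine (hξ.pos_mul_atTop one_pos hc).congr' ?_
    filter_upwards [hc.eventually_gt_atTop 0] with i hi
    field_simp
  obtain ⟨U, hU⟩ := eventually_atTop.1 (hf.eventually_hasDerivAt_log.and
    (hd.eventually (Metric.ball_mem_nhds α one_pos)))
  set h : ℝ → ℝ := fun u => log (f (exp u))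
  have hlip : ∀ u ≥ U, ∀ v ≥ U, ‖h v - h u‖ ≤ (|α| + 1) * ‖v - u‖ := by
    intro u hu v hv
    refine (convex_Ici U).norm_image_sub_le_of_norm_deriv_le (f := h)
      (fun w hw => (hU w hw).1.differentiableAt) (fun w hw => ?_) hu hv
    have := (hU w hw).2
    rw [dist_eq, abs_lt] at this
    rw [norm_eq_abs]
    have h1 := abs_sub_abs_le_abs_sub (deriv h w) α
    have h2 : |deriv h w - α| ≤ 1 := abs_le.2 ⟨this.1.le, this.2.le⟩
    linarith
  have hlog : Tendsto (fun i => log (ξ i / c i)) l (𝓝 0) := by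
    simpa using hξ.log one_ne_zero
  have hb : Tendsto (fun i => (|α| + 1) * ‖log (ξ i / c i)‖) l (𝓝 0) := by
    simpa using hlog.norm.const_mul (|α| + 1)
  have hdiff : Tendsto (fun i => log (f (ξ i)) - log (f (c i))) l (𝓝 0) := by
    refine squeeze_zero_norm' ?_ hb
    filter_upwards [hc.eventually_gt_atTop 0, hξt.eventually_gt_atTop 0,
      (tendsto_log_atTop.comp hc).eventually_ge_atTop U,
      (tendsto_log_atTop.comp hξt).eventually_ge_atTop U] with i h1 h2 h3 h4
    have := hlip _ h3 _ h4
    simp only [Function.comp_apply, h, exp_log h1, exp_log h2] at this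
    rwa [log_div h2.ne' h1.ne']
  have := (Real.continuous_exp.tendsto 0).comp hdiff
  rw [exp_zero] at this
  refine this.congr' ?_
  filter_upwards [hc.eventually_gt_atTop z₀, hξt.eventually_gt_atTop z₀] with i h1 h2
  rw [Function.comp_apply, exp_sub, exp_log (hpos _ h1), exp_log (hpos _ h2)]

lemma SmoothRegVary.tendsto_ratio_deriv_deriv (hα : 1 < α) (hf : SmoothRegVary α f) {ι : Type*}
    {l : Filter ι} {c ξ : ι → ℝ}
    (hc : Tendsto c l atTop) (hξ : Tendsto (fun i => ξ i / c i) l (𝓝 1)) :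
    Tendsto (fun i => deriv (deriv f) (ξ i) / deriv (deriv f) (c i)) l (𝓝 1) := by
  obtain ⟨z₀, hz₀, hpos, hcd, hd, -⟩ := id hf
  have hξt : Tendsto ξ l atTop := by
    refine (hξ.pos_mul_atTop one_pos hc).congr' ?_
    filter_upwards [hc.eventually_gt_atTop 0] with i hi
    field_simp
  have hA : 0 < α * (α - 1) := mul_pos (by linarith) (by linarith)
  have t1 := (hf.tendsto_deriv_deriv.comp hξt).div (hf.tendsto_deriv_deriv.comp hc) hA.ne'
  have t2 := (t1.mul (hf.tendsto_ratio hc hξ)).mul ((hξ.inv₀ one_ne_zero).pow 2)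
  rw [div_self hA.ne', inv_one, one_pow, mul_one, mul_one] at t2
  refine t2.congr' ?_
  filter_upwards [hc.eventually_gt_atTop z₀, hξt.eventually_gt_atTop z₀] with i h1 h2
  have := hpos _ h1
  have := hpos _ h2
  have : 0 < c i := by linarith
  have : 0 < ξ i := by linarith
  simp only [Pi.div_apply, Function.comp_apply]
  field_simp

lemma SmoothRegVary.eventually_deriv_pos (hα : 1 < α) (hf : SmoothRegVary α f) :
    ∀ᶠ x in atTop, 0 < deriv f x ∧ 0 < deriv (deriv f) x := by
  have hA : 0 < α * (α - 1) := mul_pos (by linarith) (by linarith)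
  filter_upwards [hf.tendsto_deriv.eventually (lt_mem_nhds (show 0 < α by linarith)),
    hf.tendsto_deriv_deriv.eventually (lt_mem_nhds hA), hf.eventually_hasDerivAt,
    eventually_gt_atTop 0] with x h1 h2 h3 hx
  have hfx := (h3 x le_rfl).1
  rw [lt_div_iff₀ hfx, zero_mul] at h1 h2
  exact ⟨(mul_pos_iff_of_pos_left hx).1 h1, (mul_pos_iff_of_pos_left (by positivity)).1 h2⟩

lemma SmoothRegVary.tendsto_div_id (hα : 1 < α) (hf : SmoothRegVary α f) :
    Tendsto (fun x => f x / x) atTop atTop := by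
  obtain ⟨z₀, hz₀, hpos, hcd, hd, -⟩ := id hf
  set k := (α - 1) / 2
  have hk : 0 < k := by simp only [k]; linarith
  obtain ⟨U, hU⟩ := eventually_atTop.1 (hf.eventually_hasDerivAt_log.and
    (hd.eventually (lt_mem_nhds (show 1 + k < α by simp only [k]; linarith))))
  set h : ℝ → ℝ := fun u => log (f (exp u))
  have hlow : ∀ u ≥ U, (1 + k) * (u - U) ≤ h u - h U := by
    intro u hu
    refine (convex_Ici U).mul_sub_le_image_sub_of_le_deriv (f := h)
      (fun w hw => (hU w hw).1.continuousAt.continuousWithinAt)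
      (fun w hw => (hU w (interior_subset hw)).1.differentiableAt.differentiableWithinAt)
      (fun w hw => (hU w (interior_subset hw)).2.le) U self_mem_Ici u hu hu
  have t : Tendsto (fun u => k * u + (h U - (1 + k) * U)) atTop atTop :=
    tendsto_atTop_add_const_right _ _ (tendsto_id.const_mul_atTop hk)
  have t2 : Tendsto (fun u => h u - u) atTop atTop := by
    refine tendsto_atTop_mono' _ ?_ t
    filter_upwards [eventually_ge_atTop U] with u hu
    have := hlow u hu
    linarith
  refine ((tendsto_exp_atTop.comp t2).comp tendsto_log_atTop).congr' ?_
  filter_upwards [eventually_gt_atTop z₀] with x hx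
  have hx0 : 0 < x := by linarith
  simp only [Function.comp_apply, h]
  rw [exp_log hx0, exp_sub, exp_log hx0, exp_log (hpos x hx)]

lemma SmoothRegVary.tendsto_atTop (hα : 1 < α) (hf : SmoothRegVary α f) : Tendsto f atTop atTop := by
  refine ((hf.tendsto_div_id hα).atTop_mul_atTop₀ tendsto_id).congr' ?_
  filter_upwards [eventually_gt_atTop 0] with x hx
  simp [hx.ne']

lemma SmoothRegVary.tendsto_sq_mul_deriv_deriv (hα : 1 < α) (hf : SmoothRegVary α f) :
    Tendsto (fun x => x ^ 2 * deriv (deriv f) x) atTop atTop := by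
  have hA : 0 < α * (α - 1) := mul_pos (by linarith) (by linarith)
  refine (hf.tendsto_deriv_deriv.pos_mul_atTop hA (hf.tendsto_atTop hα)).congr' ?_
  filter_upwards [hf.eventually_hasDerivAt] with x hx
  have := (hx x le_rfl).1
  field_simp

lemma SmoothRegVary.tendsto_deriv_div (hα : 1 < α) (hf : SmoothRegVary α f) :
    Tendsto (fun x => deriv f x / (x * deriv (deriv f) x)) atTop (𝓝 (α - 1)⁻¹) := by
  have hA : 0 < α * (α - 1) := mul_pos (by linarith) (by linarith)
  have t := hf.tendsto_deriv.div hf.tendsto_deriv_deriv hA.ne'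
  rw [show α / (α * (α - 1)) = (α - 1)⁻¹ by
    have : α - 1 ≠ 0 := by linarith
    field_simp] at t
  refine t.congr' ?_
  filter_upwards [hf.eventually_hasDerivAt, eventually_gt_atTop 0] with x hx hx0
  have := (hx x le_rfl).1
  simp only [Pi.div_apply]
  field_simp

lemma exists_taylor_two {c ξ : ℝ} (h : ∀ y ∈ uIcc c ξ, HasDerivAt f (deriv f y) y ∧
      HasDerivAt (deriv f) (deriv (deriv f) y) y) :
    ∃ ζ ∈ uIcc c ξ, f ξ - f c - deriv f c * (ξ - c) = deriv (deriv f) ζ / 2 * (ξ - c) ^ 2 := by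
  rcases eq_or_ne c ξ with rfl | hne
  · exact ⟨c, left_mem_uIcc, by ring⟩
  set M := (f ξ - f c - deriv f c * (ξ - c)) / ((ξ - c) ^ 2 / 2) with hM
  have hne' : ξ - c ≠ 0 := sub_ne_zero.2 hne.symm
  set k : ℝ → ℝ := fun y => f ξ - f y - deriv f y * (ξ - y) - M * ((ξ - y) ^ 2 / 2) with hk
  have hkc : k c = 0 := by simp only [hk, hM]; field_simp; ring
  have hkξ : k ξ = 0 := by simp [hk]
  have hder : ∀ y ∈ uIcc c ξ, HasDerivAt k ((M - deriv (deriv f) y) * (ξ - y)) y := by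
    intro y hy
    have h1 := (h y hy).1
    have h2 := (h y hy).2
    have h3 : HasDerivAt (fun y => ξ - y) (-1) y := by simpa using (hasDerivAt_id y).const_sub ξ
    have h4 := ((h1.const_sub (f ξ)).sub (h2.mul h3)).sub (((h3.pow 2).div_const 2).const_mul M)
    refine h4.congr_deriv ?_
    push_cast
    ring
  have fin : ∀ y ∈ uIcc c ξ, y ≠ ξ → (M - deriv (deriv f) y) * (ξ - y) = 0 →
      f ξ - f c - deriv f c * (ξ - c) = deriv (deriv f) y / 2 * (ξ - c) ^ 2 := by
    intro y hy hyne h0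
    rcases mul_eq_zero.1 h0 with h0 | h0
    · rw [← sub_eq_zero.1 h0, hM]; field_simp
    · exact absurd (sub_eq_zero.1 h0).symm hyne
  have hcont : ContinuousOn k (uIcc c ξ) := fun y hy => (hder y hy).continuousAt.continuousWithinAt
  rcases hne.lt_or_gt with hlt | hlt
  · rw [uIcc_of_le hlt.le] at hcont hder fin ⊢
    obtain ⟨y, hy, h0⟩ := exists_hasDerivAt_eq_zero hlt hcont (hkc.trans hkξ.symm)
      fun y hy => hder y (Ioo_subset_Icc_self hy)
    exact ⟨y, Ioo_subset_Icc_self hy, fin y (Ioo_subset_Icc_self hy) hy.2.ne h0⟩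
  · rw [uIcc_of_ge hlt.le] at hcont hder fin ⊢
    obtain ⟨y, hy, h0⟩ := exists_hasDerivAt_eq_zero hlt hcont (hkξ.trans hkc.symm)
      fun y hy => hder y (Ioo_subset_Icc_self hy)
    exact ⟨y, Ioo_subset_Icc_self hy, fin y (Ioo_subset_Icc_self hy) hy.1.ne' h0⟩

end RegularVariation

lemma Filter.Tendsto.zero_mul_of_abs_le {ι : Type*} {l : Filter ι} {x y : ι → ℝ} {M : ℝ}
    (hx : Tendsto x l (𝓝 0)) (hy : ∀ᶠ i in l, |y i| ≤ M) :
    Tendsto (fun i => x i * y i) l (𝓝 0) :=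
  hx.zero_mul_isBoundedUnder_le (isBoundedUnder_of_eventually_le (a := M) hy)

lemma logConcaveFun_of_convexOn {V : Type*} [AddCommGroup V] [Module ℝ V] {H : V → ℝ} {C : ℝ}
    (hC : 0 < C) (hH : ConvexOn ℝ univ H) : LogConcaveFun fun x => C * exp (-H x) := by
  intro x y a b ha hb hab
  have h := hH.2 (mem_univ x) (mem_univ y) ha.le hb.le hab
  rw [smul_eq_mul, smul_eq_mul] at h
  rw [mul_rpow hC.le (exp_pos _).le, mul_rpow hC.le (exp_pos _).le, ← exp_mul, ← exp_mul]
  calc C ^ a * exp (-H x * a) * (C ^ b * exp (-H y * b))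
      = C ^ (a + b) * exp (-(a * H x + b * H y)) := by
        rw [rpow_add hC, show -(a * H x + b * H y) = -H x * a + -H y * b by ring, exp_add]; ring
    _ ≤ _ := by
        rw [hab, rpow_one]
        exact mul_le_mul_of_nonneg_left (exp_le_exp.2 (by linarith)) hC.le

lemma measurable_comp_norm {n : ℕ} {f : ℝ → ℝ} (hmono : MonotoneOn f (Ici 0)) :
    Measurable fun u : EuclideanSpace ℝ (Fin n) => f ‖u‖ := by
  have h : Measurable fun t : ℝ => f (max t 0) := Monotone.measurable fun s t hst =>
    hmono (mem_Ici.2 (le_max_right _ _)) (mem_Ici.2 (le_max_right _ _)) (max_le_max_right 0 hst)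
  simpa [Function.comp_def] using h.comp (measurable_norm (α := EuclideanSpace ℝ (Fin n)))

section Tilt

variable {n : ℕ} [NeZero n]

local notation "E" => EuclideanSpace ℝ (Fin n)

/-- The length scale `f''(c)^(-1/2)`. -/
def localScale (f : ℝ → ℝ) (c : ℝ) : ℝ := deriv (deriv f) c ^ (-(1 : ℝ) / 2)

/-- The excess of `f ‖·‖` over its linearisation at `c e₁`, in local coordinates. -/
def tiltExponent (f : ℝ → ℝ) (c : ℝ) (u : EuclideanSpace ℝ (Fin n)) : ℝ :=
  f ‖c • EuclideanSpace.single (0 : Fin n) (1 : ℝ) + localScale f c • u‖ - f c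
    - deriv f c * (localScale f c * u 0)

/-- The exponentially tilted and rescaled jump density, normalised like `gaussDens`. -/
def tiltDens (β : ℝ) (f : ℝ → ℝ) (c : ℝ) (u : EuclideanSpace ℝ (Fin n)) : ℝ :=
  (2 * π) ^ (-(n : ℝ) / 2) * β ^ (-((n : ℝ) - 1) / 2) * exp (-tiltExponent f c u)

lemma EuclideanSpace.norm_sq_eq_add (u : E) :
    ‖u‖ ^ 2 = u 0 ^ 2 + ∑ i ∈ Finset.univ.erase (0 : Fin n), u i ^ 2 := by
  rw [EuclideanSpace.real_norm_sq_eq,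
    Finset.add_sum_erase _ (fun i => u i ^ 2) (Finset.mem_univ (0 : Fin n))]

variable {α β : ℝ} {f : ℝ → ℝ}

lemma localScale_pos {c : ℝ} (h : 0 < deriv (deriv f) c) : 0 < localScale f c :=
  rpow_pos_of_pos h _

lemma localScale_sq {c : ℝ} (h : 0 < deriv (deriv f) c) :
    localScale f c ^ 2 = (deriv (deriv f) c)⁻¹ := by
  rw [localScale, ← rpow_natCast, ← rpow_mul h.le, ← rpow_neg_one]
  norm_num

lemma SmoothRegVary.tendsto_localScale_div (hα : 1 < α) (hf : SmoothRegVary α f) :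
    Tendsto (fun c => localScale f c / c) atTop (𝓝 0) := by
  have t := (tendsto_rpow_neg_atTop (show (0 : ℝ) < 1 / 2 by norm_num)).comp
    (hf.tendsto_sq_mul_deriv_deriv hα)
  refine t.congr' ?_
  filter_upwards [eventually_gt_atTop 0, hf.eventually_deriv_pos hα] with c hc hd
  have : (c ^ 2 : ℝ) ^ (-(1 / 2) : ℝ) = c⁻¹ := by
    rw [← rpow_natCast, ← rpow_mul hc.le, ← rpow_neg_one]; norm_num
  rw [Function.comp_apply, mul_rpow (by positivity) hd.2.le, this, localScale, ← div_eq_inv_mul,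
    neg_div]

/-- Second-order expansion of `f ‖·‖` around `c e₁`, uniformly on bounded sets of local
coordinates. -/
lemma SmoothRegVary.tendsto_tiltExponent (hα : 1 < α) (hf : SmoothRegVary α f) (R : ℝ) :
    Tendsto (fun p : ℝ × E => tiltExponent f p.1 p.2 - gaussQuad (α - 1) p.2)
      (atTop ×ˢ 𝓟 (Metric.closedBall 0 R)) (𝓝 0) := by
  set L : Filter (ℝ × E) := atTop ×ˢ 𝓟 (Metric.closedBall 0 R)
  have hc : Tendsto (fun p : ℝ × E => p.1) L atTop := tendsto_fst
  have hu : ∀ᶠ p : ℝ × E in L, ‖p.2‖ ≤ R := by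
    have : ∀ᶠ u : E in 𝓟 (Metric.closedBall 0 R), ‖u‖ ≤ R :=
      eventually_principal.2 fun u hu => mem_closedBall_zero_iff.1 hu
    exact this.prod_inr _
  set B : ℝ × E → ℝ := fun p => ∑ i ∈ Finset.univ.erase (0 : Fin n), p.2 i ^ 2
  have hB0 : ∀ p, 0 ≤ B p := fun p => Finset.sum_nonneg fun i _ => sq_nonneg _
  have hnsq : ∀ p : ℝ × E, ‖p.2‖ ^ 2 = p.2 0 ^ 2 + B p := fun p => EuclideanSpace.norm_sq_eq_add p.2
  have hR2 : ∀ᶠ p : ℝ × E in L, p.2 0 ^ 2 + B p ≤ R ^ 2 := by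
    filter_upwards [hu] with p hp
    rw [← hnsq]
    exact pow_le_pow_left₀ (norm_nonneg _) hp 2
  have hu1 : ∀ᶠ p : ℝ × E in L, |p.2 0| ≤ |R| := by
    filter_upwards [hR2] with p hp
    exact sq_le_sq.1 (by linarith [hB0 p])
  have hu1sq : ∀ᶠ p : ℝ × E in L, |p.2 0 ^ 2| ≤ R ^ 2 := by
    filter_upwards [hR2] with p hp
    rw [abs_of_nonneg (sq_nonneg _)]
    linarith [hB0 p]
  have hBR : ∀ᶠ p : ℝ × E in L, |B p| ≤ R ^ 2 := by
    filter_upwards [hR2] with p hp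
    rw [abs_of_nonneg (hB0 p)]
    linarith [sq_nonneg (p.2 0)]
  set q : ℝ × E → ℝ := fun p => localScale f p.1 / p.1
  have hq : Tendsto q L (𝓝 0) := (hf.tendsto_localScale_div hα).comp hc
  set b : ℝ × E → ℝ := fun p => 1 + q p * p.2 0
  have hb : Tendsto b L (𝓝 1) := by
    simpa using (hq.zero_mul_of_abs_le hu1).const_add 1
  set w : ℝ × E → ℝ := fun p => √(b p ^ 2 + q p * (q p * B p))
  have hw : Tendsto w L (𝓝 1) := by
    simpa using ((hb.pow 2).add (hq.mul (hq.zero_mul_of_abs_le hBR))).sqrt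
  have hwb : Tendsto (fun p => w p + b p) L (𝓝 2) := by
    have := hw.add hb
    norm_num at this
    exact this
  set e : ℝ × E → ℝ := fun p => q p * B p * (w p + b p)⁻¹
  have he : Tendsto e L (𝓝 0) := by
    have := (hq.zero_mul_of_abs_le hBR).mul (hwb.inv₀ two_ne_zero)
    rwa [zero_mul] at this
  set ξ : ℝ × E → ℝ := fun p =>
    ‖p.1 • EuclideanSpace.single (0 : Fin n) (1 : ℝ) + localScale f p.1 • p.2‖
  have hξw : ∀ᶠ p in L, ξ p = p.1 * w p := by
    filter_upwards [hc.eventually_gt_atTop 0] with p hp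
    have h1 : ξ p ^ 2 = (p.1 * w p) ^ 2 := by
      have hin : 0 ≤ b p ^ 2 + q p * (q p * B p) := by
        rw [← mul_assoc, ← sq]; have := hB0 p; positivity
      rw [mul_pow, sq_sqrt hin, EuclideanSpace.norm_sq_eq_add]
      have hsum : ∑ i ∈ Finset.univ.erase (0 : Fin n), (p.1 • EuclideanSpace.single (0 : Fin n) (1 : ℝ)
          + localScale f p.1 • p.2) i ^ 2 = localScale f p.1 ^ 2 * B p := by
        rw [Finset.mul_sum]
        refine Finset.sum_congr rfl fun i hi => ?_
        simp [Finset.ne_of_mem_erase hi, mul_pow]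
      rw [hsum]
      simp only [PiLp.add_apply, PiLp.smul_apply, PiLp.single_apply, if_true, smul_eq_mul,
        mul_one, b, q]
      field_simp
    exact (pow_left_inj₀ (norm_nonneg _) (mul_nonneg hp.le (sqrt_nonneg _)) two_ne_zero).1 h1
  have hξ1 : Tendsto (fun p => ξ p / p.1) L (𝓝 1) := by
    refine hw.congr' ?_
    filter_upwards [hξw, hc.eventually_gt_atTop 0] with p h1 h2
    rw [h1]; field_simp
  have hξt : Tendsto ξ L atTop := by
    refine (hξ1.pos_mul_atTop one_pos hc).congr' ?_
    filter_upwards [hc.eventually_gt_atTop 0] with p hp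
    field_simp
  have hex : ∀ᶠ p in L, ∃ ζ, ζ ∈ uIcc p.1 (ξ p) ∧
      f (ξ p) - f p.1 - deriv f p.1 * (ξ p - p.1) = deriv (deriv f) ζ / 2 * (ξ p - p.1) ^ 2 := by
    obtain ⟨Z, hZ⟩ := Eventually.exists hf.eventually_hasDerivAt
    filter_upwards [hc.eventually_ge_atTop Z, hξt.eventually_ge_atTop Z] with p h1 h2
    exact exists_taylor_two fun y hy => (hZ y ((le_min h1 h2).trans hy.1)).2
  obtain ⟨ζ, hζ⟩ := Filter.skolem.1 hex
  have hζ1 : Tendsto (fun p => ζ p / p.1) L (𝓝 1) := by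
    rw [← tendsto_sub_nhds_zero_iff] at hξ1 ⊢
    refine squeeze_zero_norm' ?_ (tendsto_norm_zero.comp hξ1)
    filter_upwards [hζ, hc.eventually_gt_atTop 0] with p h1 h2
    have h3 := abs_sub_left_of_mem_uIcc h1.1
    rw [Function.comp_apply, norm_eq_abs, norm_eq_abs, div_sub_one h2.ne', div_sub_one h2.ne',
      abs_div, abs_div]
    gcongr
  have hratio := hf.tendsto_ratio_deriv_deriv hα hc hζ1
  set κ : ℝ × E → ℝ := fun p => deriv f p.1 / (p.1 * deriv (deriv f) p.1)
  have hκ : Tendsto κ L (𝓝 (α - 1)⁻¹) := (hf.tendsto_deriv_div hα).comp hc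
  have t1 : Tendsto (fun p => (κ p * (w p + b p)⁻¹ - (α - 1)⁻¹ / 2) * B p) L (𝓝 0) := by
    refine Tendsto.zero_mul_of_abs_le ?_ hBR
    have := (hκ.mul (hwb.inv₀ two_ne_zero)).sub_const ((α - 1)⁻¹ / 2)
    rwa [div_eq_mul_inv, sub_self] at this
  set ra : ℝ × E → ℝ := fun p => deriv (deriv f) (ζ p) / deriv (deriv f) p.1
  have t2 : Tendsto (fun p => (ra p - 1) * p.2 0 ^ 2) L (𝓝 0) := by
    refine Tendsto.zero_mul_of_abs_le ?_ hu1sq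
    have := hratio.sub_const 1
    rwa [sub_self] at this
  have t3 : Tendsto (fun p => ra p * e p * p.2 0) L (𝓝 0) := by
    refine Tendsto.zero_mul_of_abs_le ?_ hu1
    have := hratio.mul he
    rwa [mul_zero] at this
  have t4 : Tendsto (fun p => ra p * e p * e p) L (𝓝 0) := by
    have := (hratio.mul he).mul he
    rwa [mul_zero] at this
  have tot := t1.add (((t2.add (t3.const_mul 2)).add t4).div_const 2)
  simp only [mul_zero, add_zero, zero_div] at tot
  refine tot.congr' ?_
  filter_upwards [hζ, hξw, hc.eventually_gt_atTop 0, hc.eventually (hf.eventually_deriv_pos hα),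
    hwb.eventually (lt_mem_nhds two_pos)] with p h1 h2 h3 h4 h5
  obtain ⟨-, h1⟩ := h1
  have hs := localScale_pos h4.2
  have hs2 := localScale_sq h4.2
  have hin : 0 ≤ b p ^ 2 + q p * (q p * B p) := by
    rw [← mul_assoc, ← sq]; have := hB0 p; positivity
  have hw2 : w p ^ 2 = b p ^ 2 + q p * (q p * B p) := sq_sqrt hin
  have hpq : p.1 * q p = localScale f p.1 := by simp only [q]; field_simp
  have hwbe : w p - b p = q p * e p := by
    simp only [e]
    field_simp
    linear_combination hw2
  have hτ : ξ p - p.1 = localScale f p.1 * (p.2 0 + e p) := by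
    rw [h2, ← hpq]
    have : b p = 1 + q p * p.2 0 := rfl
    linear_combination p.1 * hwbe + p.1 * this
  have hT : tiltExponent f p.1 p.2 = deriv f p.1 * (localScale f p.1 * e p) +
      deriv (deriv f) (ζ p) / 2 * (ξ p - p.1) ^ 2 := by
    have h0 : tiltExponent f p.1 p.2 = f (ξ p) - f p.1 - deriv f p.1 * (localScale f p.1 * p.2 0) := rfl
    rw [h0]
    linear_combination h1 + deriv f p.1 * hτ
  have hT1 : deriv f p.1 * (localScale f p.1 * e p) = κ p * (w p + b p)⁻¹ * B p := by
    have : deriv f p.1 * (localScale f p.1 * e p) =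
      deriv f p.1 / p.1 * localScale f p.1 ^ 2 * B p * (w p + b p)⁻¹ := by
      simp only [e, q]; field_simp
    rw [this, hs2]
    simp only [κ]
    field_simp
  have hT2 : deriv (deriv f) (ζ p) / 2 * (ξ p - p.1) ^ 2 = ra p * (p.2 0 + e p) ^ 2 / 2 := by
    rw [hτ, mul_pow, hs2]
    simp only [ra]
    ring
  rw [hT, hT1, hT2, gaussQuad_eq]
  simp only [B]
  ring

lemma tiltDens_measurable (hmono : MonotoneOn f (Ici 0)) (c : ℝ) :
    Measurable (tiltDens β f c : E → ℝ) := by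
  have h1 : Measurable fun u : E =>
      f ‖c • EuclideanSpace.single (0 : Fin n) (1 : ℝ) + localScale f c • u‖ :=
    (measurable_comp_norm hmono).comp (by fun_prop)
  have h2 : Measurable fun u : E => deriv f c * (localScale f c * u 0) := by fun_prop
  exact (((h1.sub_const _).sub h2).neg.exp).const_mul _

lemma tiltDens_logConcave (hβ : 0 < β) (hconv : ConvexOn ℝ (Ici 0) f) (hmono : MonotoneOn f (Ici 0))
    (c : ℝ) : LogConcaveFun (tiltDens β f c : E → ℝ) := by
  refine logConcaveFun_of_convexOn (by positivity) ⟨convex_univ, fun x _ y _ a b ha hb hab => ?_⟩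
  unfold tiltExponent
  set e : E := EuclideanSpace.single (0 : Fin n) (1 : ℝ)
  set s := localScale f c
  have h1 : c • e + s • (a • x + b • y) = a • (c • e + s • x) + b • (c • e + s • y) := by
    obtain rfl : b = 1 - a := by linarith
    module
  have h2 : ‖c • e + s • (a • x + b • y)‖ ≤ a * ‖c • e + s • x‖ + b * ‖c • e + s • y‖ := by
    rw [h1]
    refine (norm_add_le _ _).trans ?_
    rw [norm_smul, norm_smul, norm_of_nonneg ha, norm_of_nonneg hb]
  have h3 := hmono (mem_Ici.2 (norm_nonneg _)) (mem_Ici.2 (by positivity)) h2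
  have h4 := hconv.2 (mem_Ici.2 (norm_nonneg (c • e + s • x)))
    (mem_Ici.2 (norm_nonneg (c • e + s • y))) ha hb hab
  simp only [smul_eq_mul, PiLp.add_apply, PiLp.smul_apply] at h4 ⊢
  have h5 : f c = a * f c + b * f c := by rw [← add_mul, hab, one_mul]
  linarith

/-- The tilted jump densities converge to the Gaussian density. -/
lemma SmoothRegVary.tendstoGauss (hα : 1 < α) (hf : SmoothRegVary α f)
    (hconv : ConvexOn ℝ (Ici 0) f) (hmono : MonotoneOn f (Ici 0)) :
    TendstoGauss atTop (fun c => (tiltDens (α - 1) f c : E → ℝ)) (α - 1) := by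
  have hβ : 0 < α - 1 := by linarith
  have hnn : ∀ c u, 0 ≤ (tiltDens (α - 1) f c : E → ℝ) u := fun c u => by
    unfold tiltDens; positivity
  have hlc : ∀ c, LogConcaveFun (tiltDens (α - 1) f c : E → ℝ) := tiltDens_logConcave hβ hconv hmono
  have hclose : ∀ R η : ℝ, 0 < η → ∀ᶠ c in atTop, ∀ u : E, ‖u‖ ≤ R →
      exp (-η) * gaussDens (α - 1) u ≤ tiltDens (α - 1) f c u ∧
        tiltDens (α - 1) f c u ≤ exp η * gaussDens (α - 1) u := by
    intro R η hη
    have h := (hf.tendsto_tiltExponent (n := n) hα R).eventually (Metric.ball_mem_nhds 0 hη)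
    rw [eventually_prod_principal_iff] at h
    filter_upwards [h] with c hc u hu
    have := hc u (mem_closedBall_zero_iff.2 hu)
    rw [dist_zero_right, norm_eq_abs, abs_lt] at this
    unfold tiltDens gaussDens
    have hK : 0 ≤ (2 * π) ^ (-(n : ℝ) / 2) * (α - 1) ^ (-((n : ℝ) - 1) / 2) := by positivity
    rw [mul_left_comm, ← exp_add, mul_left_comm, ← exp_add]
    exact ⟨mul_le_mul_of_nonneg_left (exp_le_exp.2 (by linarith)) hK,
      mul_le_mul_of_nonneg_left (exp_le_exp.2 (by linarith)) hK⟩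
  refine ⟨hβ, ?_, Eventually.of_forall hlc, hclose⟩
  obtain ⟨R₀, -, hR₀⟩ := exists_tail_bound (n := n) hβ
  filter_upwards [hclose R₀ 1 one_pos] with c hc
  set D : E → ℝ := fun u => gaussDens (α - 1) (0 : E) * exp (-‖u‖) + exp 1 * gaussDens (α - 1) u
  have hD : Integrable D :=
    (integrable_exp_neg_norm.const_mul _).add ((gaussDens_integrable hβ).const_mul _)
  have hle : ∀ u, tiltDens (α - 1) f c u ≤ D u := by
    intro u
    have hG := gaussDens_pos hβ u
    have hG0 := gaussDens_pos hβ (0 : E)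
    rcases le_total R₀ ‖u‖ with h | h
    · have h1 := hR₀ R₀ le_rfl _ (hlc c) (hnn c) hc u h
      have h2 : gaussDens (α - 1) (0 : E) * exp (-3 * ‖u‖) ≤ gaussDens (α - 1) (0 : E) * exp (-‖u‖) :=
        mul_le_mul_of_nonneg_left (exp_le_exp.2 (by linarith [norm_nonneg u])) hG0.le
      have : 0 ≤ exp 1 * gaussDens (α - 1) u := by positivity
      simp only [D]; linarith
    · have h1 := (hc u h).2
      have : 0 ≤ gaussDens (α - 1) (0 : E) * exp (-‖u‖) := by positivity
      simp only [D]; linarith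
  refine ⟨tiltDens_measurable hmono c, hnn c, ?_, gaussDens (α - 1) (0 : E) * 1 +
    exp 1 * gaussDens (α - 1) (0 : E), fun u => (hle u).trans (add_le_add ?_ ?_)⟩
  · refine hD.mono' (tiltDens_measurable hmono c).aestronglyMeasurable (Eventually.of_forall fun u => ?_)
    rw [norm_of_nonneg (hnn c u)]
    exact hle u
  · exact mul_le_mul_of_nonneg_left (exp_le_one_iff.2 (by simp)) (gaussDens_pos hβ _).le
  · exact mul_le_mul_of_nonneg_left (gaussDens_le hβ u) (exp_pos 1).le

lemma TendstoGauss.comp {ι κ : Type*} {l : Filter ι} {k : Filter κ} {φ : ι → E → ℝ}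
    (h : TendstoGauss l φ β) {c : κ → ι} (hc : Tendsto c k l) :
    TendstoGauss k (fun i => φ (c i)) β :=
  ⟨h.pos, hc.eventually h.dens, hc.eventually h.logConcave,
    fun R η hη => hc.eventually (h.close R η hη)⟩

end Tilt

section Scale

variable {α : ℝ} {f : ℝ → ℝ}

lemma SmoothRegVary.exists_sq_mul_deriv_deriv_le (hα : 1 < α) (hf : SmoothRegVary α f) :
    ∃ C > 0, ∀ᶠ c in atTop, c ^ 2 * deriv (deriv f) c ≤ C * f c := by
  have hA : 0 < α * (α - 1) := mul_pos (by linarith) (by linarith)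
  refine ⟨α * (α - 1) + 1, by linarith, ?_⟩
  filter_upwards [hf.tendsto_deriv_deriv.eventually (gt_mem_nhds (lt_add_one _)),
    hf.eventually_hasDerivAt] with c h1 h2
  exact ((div_lt_iff₀ (h2 c le_rfl).1).1 h1).le

lemma SmoothRegVary.eventually_le_legendre (hα : 1 < α) (hf : SmoothRegVary α f) (n : ℕ) :
    ∀ᶠ c in atTop, (α - 1) / 4 * f c ≤
      c * deriv f c - f c + log c - (n : ℝ) / 2 * log (deriv (deriv f) c) := by
  obtain ⟨C, hC, hCf⟩ := hf.exists_sq_mul_deriv_deriv_le hα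
  have hη : 0 < (α - 1) / (2 * (n + 1) * C) := div_pos (by linarith) (by positivity)
  have hlog := ((tendsto_id.const_mul_atTop hC).comp (hf.tendsto_atTop hα)).eventually
    (isLittleO_log_id_atTop.def hη)
  filter_upwards [hf.tendsto_deriv.eventually (lt_mem_nhds (show 1 + (α - 1) / 2 < α by linarith)),
    hf.eventually_hasDerivAt, hf.eventually_deriv_pos hα, eventually_ge_atTop 1, hCf, hlog]
    with c h1 h2 h3 h4 h5 h6
  have hfc := (h2 c le_rfl).1
  rw [lt_div_iff₀ hfc] at h1
  have h7 : log (deriv (deriv f) c) ≤ log (C * f c) := by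
    refine log_le_log h3.2 (le_trans ?_ h5)
    have : 1 ≤ c ^ 2 := one_le_pow₀ h4
    nlinarith [h3.2]
  simp only [Function.comp_apply, id_eq, norm_eq_abs] at h6
  rw [abs_of_pos (show 0 < C * f c by positivity)] at h6
  have h8 := (le_abs_self _).trans h6
  have h9 : (n : ℝ) / 2 * log (deriv (deriv f) c) ≤ (α - 1) / 4 * f c := by
    have e1 : (α - 1) / (2 * (n + 1) * C) * (C * f c) = (α - 1) / (2 * (n + 1)) * f c := by
      field_simp
    calc (n : ℝ) / 2 * log (deriv (deriv f) c)
        ≤ (n : ℝ) / 2 * ((α - 1) / (2 * (n + 1)) * f c) := by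
          refine mul_le_mul_of_nonneg_left ?_ (by positivity)
          rw [← e1]; exact h7.trans h8
      _ = (n / (n + 1)) * ((α - 1) / 4 * f c) := by field_simp; ring
      _ ≤ 1 * ((α - 1) / 4 * f c) := by
          refine mul_le_mul_of_nonneg_right ?_ (mul_nonneg (by linarith) hfc.le)
          rw [div_le_one (by positivity)]; linarith
      _ = _ := one_mul _
  have h10 := log_nonneg h4
  nlinarith

lemma localScale_pow {c : ℝ} (h : 0 < deriv (deriv f) c) (n : ℕ) :
    localScale f c ^ n = exp (-((n : ℝ) / 2 * log (deriv (deriv f) c))) := by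
  rw [localScale, rpow_def_of_pos h, ← exp_nat_mul]
  congr 1; ring

/-- Sizes of the localisation point `c`, the number of jumps `X / c` and the scale in the regime
`X ^ ρ ≤ t ≤ X ^ γ`. -/
lemma SmoothRegVary.scale_asymptotics (hα : 1 < α) (hf : SmoothRegVary α f) (n : ℕ) {g : ℝ → ℝ}
    {Λ₀ k : ℝ} (hk : 0 < k) (hgtop : Tendsto g atTop atTop)
    (hg : ∀ Λ : ℝ, Λ₀ < Λ → g Λ * deriv f (g Λ) - f (g Λ) + log (g Λ)
          - (n : ℝ) / 2 * log (deriv (deriv f) (g Λ)) = log (k * Λ))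
    {ι : Type*} {l : Filter ι} {X t : ι → ℝ} {ρ γ : ℝ} (hργ : ρ < γ) (hγ : γ < 1)
    (hX : Tendsto X l atTop) (ht : ∀ᶠ i in l, 0 < t i)
    (hXt : ∀ᶠ i in l, X i ^ ρ ≤ t i ∧ t i ≤ X i ^ γ) :
    Tendsto (fun i => g (X i / t i)) l atTop ∧
    Tendsto (fun i => X i / g (X i / t i)) l atTop ∧
    Tendsto (fun i => g (X i / t i) / localScale f (g (X i / t i)) / (X i / g (X i / t i))) l (𝓝 0) ∧
    Tendsto (fun i => g (X i / t i) / localScale f (g (X i / t i))) l atTop ∧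
    ∀ᶠ i in l, t i * localScale f (g (X i / t i)) ^ n * k⁻¹ *
      exp (deriv f (g (X i / t i)) * g (X i / t i) - f (g (X i / t i))) = X i / g (X i / t i) := by
  have hΛ : Tendsto (fun i => X i / t i) l atTop := by
    refine tendsto_atTop_mono' _ ?_ ((tendsto_rpow_atTop (show 0 < 1 - γ by linarith)).comp hX)
    filter_upwards [ht, hXt, hX.eventually_gt_atTop 0] with i h1 h2 h3
    rw [Function.comp_apply, le_div_iff₀ h1, rpow_sub h3, rpow_one]
    calc X i / X i ^ γ * t i ≤ X i / X i ^ γ * X i ^ γ :=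
          mul_le_mul_of_nonneg_left h2.2 (by positivity)
      _ = X i := by field_simp
  set c : ι → ℝ := fun i => g (X i / t i)
  have hc : Tendsto c l atTop := hgtop.comp hΛ
  have hfc : Tendsto (fun i => f (c i)) l atTop := (hf.tendsto_atTop hα).comp hc
  have hinv : Tendsto (fun i => (f (c i))⁻¹) l (𝓝 0) := tendsto_inv_atTop_zero.comp hfc
  have hdpos := hc.eventually (hf.eventually_deriv_pos hα)
  set η := (α - 1) / (8 * (1 - ρ)) with hη_def
  have hρ : 0 < 1 - ρ := by linarith
  have hη : 0 < η := div_pos (by linarith) (by linarith)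
  have hXf : ∀ᶠ i in l, f (c i) ^ 4 ≤ X i := by
    have h4 := hfc.eventually ((isLittleO_pow_exp_pos_mul_atTop 4 hη).def one_pos)
    filter_upwards [hc.eventually (hf.eventually_le_legendre hα n), hΛ.eventually_gt_atTop Λ₀,
      hΛ.eventually_gt_atTop 0, hX.eventually_gt_atTop 0, ht, hXt, h4,
      hfc.eventually_ge_atTop (8 / (α - 1) * log k)] with i h1 h2 h3 h5 h6 h7 h8 h9
    rw [hg _ h2, log_mul hk.ne' h3.ne', log_div h5.ne' h6.ne'] at h1
    have h10 : ρ * log (X i) ≤ log (t i) := by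
      rw [← log_rpow h5]; exact log_le_log (by positivity) h7.1
    have h11 : log k ≤ (α - 1) / 8 * f (c i) := by
      have hα' : α - 1 ≠ 0 := by linarith
      calc log k = (α - 1) / 8 * (8 / (α - 1) * log k) := by field_simp
        _ ≤ _ := mul_le_mul_of_nonneg_left h9 (by linarith)
    have h12 : η * f (c i) ≤ log (X i) := by
      have e1 : (1 - ρ) * (η * f (c i)) = (α - 1) / 8 * f (c i) := by
        rw [hη_def]; field_simp
      refine le_of_mul_le_mul_left ?_ hρ
      rw [e1]; linarith
    rw [norm_eq_abs, norm_eq_abs, one_mul, abs_of_pos (exp_pos _)] at h8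
    calc f (c i) ^ 4 ≤ exp (η * f (c i)) := (le_abs_self _).trans h8
      _ ≤ exp (log (X i)) := exp_le_exp.2 h12
      _ = X i := exp_log h5
  have hcf : ∀ᶠ i in l, c i ≤ f (c i) := by
    filter_upwards [hc.eventually ((hf.tendsto_div_id hα).eventually_ge_atTop 1),
      hc.eventually_gt_atTop 0] with i h1 h2
    rwa [le_div_iff₀ h2, one_mul] at h1
  have hasq : ∀ᶠ i in l, (c i / localScale f (c i)) ^ 2 = c i ^ 2 * deriv (deriv f) (c i) := by
    filter_upwards [hdpos] with i h1
    rw [div_pow, localScale_sq h1.2, div_inv_eq_mul]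
  obtain ⟨C, hC, hCf⟩ := hf.exists_sq_mul_deriv_deriv_le hα
  refine ⟨hc, ?_, ?_, ?_, ?_⟩
  · refine tendsto_atTop_mono' _ ?_ hfc
    filter_upwards [hXf, hcf, hc.eventually_gt_atTop 0, hfc.eventually_ge_atTop 1]
      with i h1 h2 h3 h4
    rw [le_div_iff₀ h3]
    calc f (c i) * c i ≤ f (c i) * f (c i) := mul_le_mul_of_nonneg_left h2 (by linarith)
      _ = f (c i) ^ 2 := by ring
      _ ≤ f (c i) ^ 4 := pow_le_pow_right₀ h4 (by norm_num)
      _ ≤ X i := h1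
  · have hb : Tendsto (fun i => (C + 1) * (f (c i))⁻¹) l (𝓝 0) := by
      simpa using hinv.const_mul (C + 1)
    refine squeeze_zero' ?_ ?_ hb
    · filter_upwards [hdpos, hc.eventually_gt_atTop 0, hX.eventually_gt_atTop 0] with i h1 h2 h3
      have := localScale_pos h1.2
      positivity
    · filter_upwards [hXf, hcf, hc.eventually_gt_atTop 0, hfc.eventually_ge_atTop 1,
        hX.eventually_gt_atTop 0, hdpos, hasq, hc.eventually hCf] with i h1 h2 h3 h4 h5 h6 h7 h8
      have hf0 : 0 < f (c i) := by linarith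
      set a := c i / localScale f (c i)
      have h9 : a * c i ≤ (C + 1) * f (c i) ^ 2 := by
        have e1 : a * c i ≤ a ^ 2 + c i ^ 2 := by nlinarith [sq_nonneg (a - c i), sq_nonneg (a + c i)]
        have e2 : c i ^ 2 ≤ f (c i) ^ 2 := pow_le_pow_left₀ h3.le h2 2
        have e3 : C * f (c i) ≤ C * f (c i) ^ 2 :=
          mul_le_mul_of_nonneg_left (by nlinarith) hC.le
        linarith
      have e4 : f (c i) ^ 3 ≤ f (c i) ^ 4 := pow_le_pow_right₀ h4 (by norm_num)
      rw [div_div_eq_mul_div, div_le_iff₀ h5]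
      calc a * c i ≤ (C + 1) * f (c i) ^ 2 := h9
        _ = (C + 1) * (f (c i))⁻¹ * f (c i) ^ 3 := by field_simp
        _ ≤ (C + 1) * (f (c i))⁻¹ * X i :=
          mul_le_mul_of_nonneg_left (e4.trans h1) (by positivity)
  · have h := (((hf.tendsto_localScale_div hα).comp hc))
    have hpos : ∀ᶠ i in l, localScale f (c i) / c i ∈ Ioi (0 : ℝ) := by
      filter_upwards [hdpos, hc.eventually_gt_atTop 0] with i h1 h2
      exact div_pos (localScale_pos h1.2) h2
    have := (tendsto_nhdsWithin_iff.2 ⟨h, hpos⟩).inv_tendsto_nhdsGT_zero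
    refine this.congr fun i => ?_
    simp [c]
  · filter_upwards [hdpos, hΛ.eventually_gt_atTop Λ₀, hΛ.eventually_gt_atTop 0, ht,
      hc.eventually_gt_atTop 0] with i h1 h2 h3 h4 h5
    have e := congrArg exp (hg _ h2)
    rw [exp_log (by positivity)] at e
    rw [sub_eq_add_neg, exp_add, exp_add, exp_log h5, ← localScale_pow h1.2,
      mul_comm (g _)] at e
    rw [eq_div_iff h5.ne']
    have : t i * localScale f (c i) ^ n * k⁻¹ * exp (deriv f (c i) * c i - f (c i)) * c i =
      t i * k⁻¹ * (exp (deriv f (c i) * c i - f (c i)) * c i * localScale f (c i) ^ n) := by ring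
    change t i * localScale f (c i) ^ n * k⁻¹ * exp (deriv f (c i) * c i - f (c i)) * c i = X i
    rw [this, e]
    field_simp

end Scale

section Window

variable {n : ℕ} [NeZero n] {ι : Type*} {l : Filter ι} {φ : ι → EuclideanSpace ℝ (Fin n) → ℝ}
  {β : ℝ}

/-- Most of the jump weight sits on jump numbers for which consecutive convolution powers compare
well. -/
lemma TendstoGauss.exists_window (h : TendstoGauss l φ β) {N a : ι → ℝ}
    {e : EuclideanSpace ℝ (Fin n)} (hN : Tendsto N l atTop) (ha : Tendsto a l atTop)
    (haN : Tendsto (fun i => a i / N i) l (𝓝 0)) (he : ‖e‖ = 1) {δ : ℝ} (hδ : 0 < δ) (hδ1 : δ < 1)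
    (K : ℝ) :
    ∀ᶠ i in l, Summable (jumpWeight (φ i) (N i) (a i) e) ∧
      0 < ∑' m, jumpWeight (φ i) (N i) (a i) e m ∧
      ∃ Ω : Set ℕ, (1 - δ) * ∑' m, jumpWeight (φ i) (N i) (a i) e m ≤
          ∑' m, Ω.indicator (fun m => jumpWeight (φ i) (N i) (a i) e (m + 1)) m ∧
        ∀ m ∈ Ω, ∀ v, v = ((N i - ((m : ℝ) + 2)) * a i) • e → ∀ u, ‖u‖ ≤ K →
          0 < convPow n (φ i) (m + 1) v ∧
          (1 - δ) * gaussDens β u * convPow n (φ i) (m + 1) v ≤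
            φ i u * convPow n (φ i) m (v - u) := by
  obtain ⟨κ, hκ, hκ1, m₀, hm₀⟩ := h.exists_jump_bound (K := K) hδ hδ1
  have hw := h.jumpWeight_window hN (ha.eventually_gt_atTop 0) haN he (κ := κ / 4) (by positivity)
    (by linarith) hδ
  filter_upwards [hm₀, hw, hN.eventually_ge_atTop 2, hN.eventually_ge_atTop (2 * (m₀ + 2)),
    ha.eventually_ge_atTop 1] with i h1 h2 h3 h4 h5
  obtain ⟨hs, hpos, hwin⟩ := h2
  set W := jumpWeight (φ i) (N i) (a i) e
  set V : Set ℕ := {m | κ / 4 * N i < |N i - ((m : ℝ) + 1)| * a i} with hV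
  have hmem : ∀ m, m ∉ V → |N i - ((m : ℝ) + 1)| * a i ≤ κ / 4 * N i := fun m hm => not_lt.1 hm
  have hdist : ∀ m, m ∉ V → 3 / 4 * N i ≤ (m : ℝ) + 1 := by
    intro m hm
    have h6 := hmem m hm
    have h7 : |N i - ((m : ℝ) + 1)| ≤ κ / 4 * N i :=
      (le_mul_of_one_le_right (abs_nonneg _) h5).trans h6
    have h8 := (le_abs_self _).trans h7
    nlinarith
  refine ⟨hs, hpos, {m | m + 1 ∉ V}, ?_, ?_⟩
  · have e1 : ∑' m, W m = ∑' m, V.indicator W m + ∑' m, Vᶜ.indicator W m := by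
      rw [← (hs.indicator V).tsum_add (hs.indicator Vᶜ)]
      exact tsum_congr fun m => (congrFun (indicator_self_add_compl V W) m).symm
    have h0 : (0 : ℕ) ∈ V := by
      by_contra h0
      have := hdist 0 h0
      push_cast at this
      nlinarith [h3]
    have e2 : ∑' m, Vᶜ.indicator W m = ∑' m, Vᶜ.indicator W (m + 1) := by
      rw [(hs.indicator Vᶜ).tsum_eq_zero_add, indicator_of_notMem (by simpa using h0), zero_add]
    have e3 : ∀ m, Vᶜ.indicator W (m + 1) =
        ({m | m + 1 ∉ V} : Set ℕ).indicator (fun m => W (m + 1)) m := fun m => rfl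
    have e4 : ∑' m, Vᶜ.indicator W (m + 1) =
        ∑' m, ({m | m + 1 ∉ V} : Set ℕ).indicator (fun m => W (m + 1)) m := tsum_congr e3
    rw [← e4]
    linarith
  · intro m hm v hv u hu
    have h6 := hmem (m + 1) hm
    have h7 := hdist (m + 1) hm
    push_cast at h6 h7
    refine h1 m ?_ v u ?_ hu
    · have : (m₀ : ℝ) ≤ m := by linarith
      exact_mod_cast this
    · rw [hv, norm_smul, he, mul_one, norm_mul, norm_eq_abs, norm_of_nonneg (by linarith)]
      rw [add_assoc, one_add_one_eq_two] at h6
      refine h6.trans ?_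
      nlinarith

end Window

section Bridge

variable {n : ℕ} [NeZero n]

local notation "E" => EuclideanSpace ℝ (Fin n)

/-- Normalising constant of `gaussDens`. -/
def gaussConst (n : ℕ) (β : ℝ) : ℝ := (2 * π) ^ (-(n : ℝ) / 2) * β ^ (-((n : ℝ) - 1) / 2)

omit [NeZero n] in
lemma gaussConst_pos {β : ℝ} (hβ : 0 < β) : 0 < gaussConst n β := by
  unfold gaussConst; positivity

variable {β : ℝ} {f : ℝ → ℝ} {c t X : ℝ}

lemma exp_neg_eq_tiltDens (hβ : 0 < β) (u : E) :
    exp (-f ‖c • EuclideanSpace.single (0 : Fin n) (1 : ℝ) + localScale f c • u‖) =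
      (gaussConst n β)⁻¹ * exp (-f c) *
        exp (((-(deriv f c * localScale f c)) • EuclideanSpace.proj (0 : Fin n) : E →L[ℝ] ℝ) u) *
        tiltDens β f c u := by
  have hk := gaussConst_pos (n := n) hβ
  have h1 : tiltDens β f c u = gaussConst n β * exp (-tiltExponent f c u) := rfl
  have h2 : ((-(deriv f c * localScale f c)) • EuclideanSpace.proj (0 : Fin n) : E →L[ℝ] ℝ) u =
    -(deriv f c * localScale f c) * u 0 := rfl
  rw [h1, h2, tiltExponent]
  calc _ = exp (-f c + -(deriv f c * localScale f c) * u 0 + -(f ‖c • EuclideanSpace.single (0 : Fin n)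
        (1 : ℝ) + localScale f c • u‖ - f c - deriv f c * (localScale f c * u 0))) := by
        congr 1; ring
    _ = _ := by
        rw [exp_add, exp_add]; field_simp

/-- Convolution powers of the jump density in local coordinates. -/
lemma convPow_exp_neg (hβ : 0 < β) (hs : 0 < localScale f c) (m : ℕ) (v : E) :
    convPow n (fun w => exp (-f ‖w‖)) m (((m : ℝ) + 1) • c • EuclideanSpace.single (0 : Fin n) (1 : ℝ) +
      localScale f c • v) = localScale f c ^ (n * m) * ((gaussConst n β)⁻¹ * exp (-f c)) ^ (m + 1) *
      exp (-(deriv f c * localScale f c) * v 0) * convPow n (tiltDens β f c) m v :=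
  convPow_affine (p := fun w => exp (-f ‖w‖)) (φ := tiltDens β f c)
    (b := c • EuclideanSpace.single (0 : Fin n) (1 : ℝ)) hs
    ((-(deriv f c * localScale f c)) • EuclideanSpace.proj (0 : Fin n) : E →L[ℝ] ℝ)
    (exp_neg_eq_tiltDens hβ) m v

lemma smul_single_eq (hc : c ≠ 0) (hs : 0 < localScale f c) (b : ℝ) :
    X • EuclideanSpace.single (0 : Fin n) (1 : ℝ) =
      b • c • EuclideanSpace.single (0 : Fin n) (1 : ℝ) +
        localScale f c • ((X / c - b) * (c / localScale f c)) •
          EuclideanSpace.single (0 : Fin n) (1 : ℝ) := by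
  rw [smul_smul, smul_smul, ← add_smul]
  congr 1
  field_simp
  ring

/-- The weights of the jump numbers are proportional to `jumpWeight`. -/
lemma mul_convPow_eq_jumpWeight (hβ : 0 < β) (hc : 0 < c) (hs : 0 < localScale f c)
    (ht : t * localScale f c ^ n * (gaussConst n β)⁻¹ * exp (deriv f c * c - f c) = X / c) (m : ℕ) :
    t ^ (m + 1) / (Nat.factorial (m + 1) : ℝ) * convPow n (fun w => exp (-f ‖w‖)) m
      (X • EuclideanSpace.single (0 : Fin n) (1 : ℝ)) =
    (localScale f c ^ n)⁻¹ * exp (-(deriv f c * X)) *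
      jumpWeight (tiltDens β f c) (X / c) (c / localScale f c)
        (EuclideanSpace.single (0 : Fin n) (1 : ℝ)) m := by
  have hk := gaussConst_pos (n := n) hβ
  rw [smul_single_eq hc.ne' hs ((m : ℝ) + 1), convPow_exp_neg hβ hs, jumpWeight]
  have e1 : -(deriv f c * localScale f c) * ((((X / c - ((m : ℝ) + 1)) * (c / localScale f c)) •
      EuclideanSpace.single (0 : Fin n) (1 : ℝ) : E) 0) =
      -(deriv f c * X) + ((m + 1 : ℕ) : ℝ) * (deriv f c * c) := by
    push_cast
    simp
    field_simp
    ring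
  have e2 : (X / c) ^ (m + 1) = t ^ (m + 1) * (localScale f c ^ (n * m) * localScale f c ^ n) *
      ((gaussConst n β)⁻¹ * exp (-f c)) ^ (m + 1) * exp (((m + 1 : ℕ) : ℝ) * (deriv f c * c)) := by
    rw [← ht, exp_nat_mul, sub_eq_add_neg, exp_add]
    simp only [mul_pow]
    ring
  rw [e1, e2, exp_add]
  field_simp

lemma cpDensity_eq (hβ : 0 < β) (hc : 0 < c) (hs : 0 < localScale f c)
    (ht : t * localScale f c ^ n * (gaussConst n β)⁻¹ * exp (deriv f c * c - f c) = X / c) :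
    cpDensity n f t (X • EuclideanSpace.single (0 : Fin n) (1 : ℝ)) =
    exp (-t) * ((localScale f c ^ n)⁻¹ * exp (-(deriv f c * X))) *
      ∑' m, jumpWeight (tiltDens β f c) (X / c) (c / localScale f c)
        (EuclideanSpace.single (0 : Fin n) (1 : ℝ)) m := by
  rw [cpDensity, ← tsum_mul_left]
  refine tsum_congr fun m => ?_
  rw [mul_div_assoc, mul_assoc, mul_convPow_eq_jumpWeight hβ hc hs ht]
  ring

lemma jumpCountProb_eq (hβ : 0 < β) (hc : 0 < c) (hs : 0 < localScale f c)
    (ht : t * localScale f c ^ n * (gaussConst n β)⁻¹ * exp (deriv f c * c - f c) = X / c) (m : ℕ) :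
    jumpCountProb n f t (X • EuclideanSpace.single (0 : Fin n) (1 : ℝ)) (m + 1) =
      jumpWeight (tiltDens β f c) (X / c) (c / localScale f c)
        (EuclideanSpace.single (0 : Fin n) (1 : ℝ)) m /
      ∑' m, jumpWeight (tiltDens β f c) (X / c) (c / localScale f c)
        (EuclideanSpace.single (0 : Fin n) (1 : ℝ)) m := by
  rw [jumpCountProb, cpDensity_eq hβ hc hs ht, Nat.add_sub_cancel, mul_div_assoc (exp (-t)),
    mul_assoc (exp (-t)), mul_convPow_eq_jumpWeight hβ hc hs ht, ← mul_assoc (exp (-t)),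
    mul_div_mul_left _ _ (by positivity)]

/-- The single-jump density in local coordinates. -/
lemma singleJumpDensity_eq (hβ : 0 < β) (hc : 0 < c) (hs : 0 < localScale f c) (m : ℕ) (u v : E)
    (hv : v = ((X / c - ((m : ℝ) + 2)) * (c / localScale f c)) •
      EuclideanSpace.single (0 : Fin n) (1 : ℝ)) :
    singleJumpDensity n f (X • EuclideanSpace.single (0 : Fin n) (1 : ℝ)) (m + 2)
      (c • EuclideanSpace.single (0 : Fin n) (1 : ℝ) + localScale f c • u) =
    (localScale f c ^ n)⁻¹ * ((convPow n (tiltDens β f c) (m + 1) v)⁻¹ *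
      (tiltDens β f c u * convPow n (tiltDens β f c) m (v - u))) := by
  have hk := gaussConst_pos (n := n) hβ
  set e : E := EuclideanSpace.single (0 : Fin n) (1 : ℝ) with he
  have hX : X • e = (((m + 1 : ℕ) : ℝ) + 1) • c • e + localScale f c • v := by
    rw [hv, smul_single_eq hc.ne' hs (((m + 1 : ℕ) : ℝ) + 1)]
    push_cast
    rw [add_assoc ((m : ℝ)), one_add_one_eq_two]
  have hXu : X • e - (c • e + localScale f c • u) =
      ((m : ℝ) + 1) • c • e + localScale f c • (v - u) := by
    rw [hX]; push_cast; module
  have h1 := convPow_exp_neg (f := f) (c := c) hβ hs (m + 1) v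
  have h2 := convPow_exp_neg (f := f) (c := c) hβ hs m (v - u)
  have h3 := exp_neg_eq_tiltDens (f := f) (c := c) hβ u
  have h4 : ((-(deriv f c * localScale f c)) • EuclideanSpace.proj (0 : Fin n) : E →L[ℝ] ℝ) u =
    -(deriv f c * localScale f c) * u 0 := rfl
  rw [← he] at h1 h2 h3
  rw [singleJumpDensity, Nat.add_sub_cancel, hXu, hX, show m + 2 - 1 = m + 1 from rfl, h1, h2, h3, h4]
  have h5 : exp (-(deriv f c * localScale f c) * v 0) =
      exp (-(deriv f c * localScale f c) * u 0) * exp (-(deriv f c * localScale f c) * (v - u) 0) := by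
    rw [← exp_add, PiLp.sub_apply]; congr 1; ring
  rw [h5, Nat.mul_succ, pow_add, pow_succ _ (m + 1)]
  simp only [mul_inv]
  field_simp

/-- The target normal density in local coordinates. -/
lemma gaussDens_local_eq (hd : 0 < deriv (deriv f) c) (u : E) :
    (deriv (deriv f) c / (2 * π)) ^ ((n : ℝ) / 2) * β ^ (-((n : ℝ) - 1) / 2) *
      exp (-(deriv (deriv f) c / 2) *
        (((c • EuclideanSpace.single (0 : Fin n) (1 : ℝ) + localScale f c • u : E) 0 - c) ^ 2 +
          β⁻¹ * ∑ i ∈ Finset.univ.erase (0 : Fin n),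
            (c • EuclideanSpace.single (0 : Fin n) (1 : ℝ) + localScale f c • u : E) i ^ 2)) =
    (localScale f c ^ n)⁻¹ * gaussDens β u := by
  have hsum : ∑ i ∈ Finset.univ.erase (0 : Fin n),
      (c • EuclideanSpace.single (0 : Fin n) (1 : ℝ) + localScale f c • u : E) i ^ 2 =
      localScale f c ^ 2 * ∑ i ∈ Finset.univ.erase (0 : Fin n), u i ^ 2 := by
    rw [Finset.mul_sum]
    refine Finset.sum_congr rfl fun i hi => ?_
    simp [Finset.ne_of_mem_erase hi, mul_pow]
  have h0 : (c • EuclideanSpace.single (0 : Fin n) (1 : ℝ) + localScale f c • u : E) 0 - c =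
      localScale f c * u 0 := by simp
  have h1 : (deriv (deriv f) c / (2 * π)) ^ ((n : ℝ) / 2) =
      (localScale f c ^ n)⁻¹ * (2 * π) ^ (-(n : ℝ) / 2) := by
    have e1 : (localScale f c ^ n)⁻¹ = deriv (deriv f) c ^ ((n : ℝ) / 2) := by
      rw [localScale, ← rpow_natCast, ← rpow_mul hd.le, ← rpow_neg hd.le]
      congr 1; ring
    rw [div_rpow hd.le (by positivity), e1, neg_div, rpow_neg (by positivity), div_eq_mul_inv]
  rw [hsum, h0, h1, gaussDens, gaussQuad_eq, mul_pow, localScale_sq hd]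
  rw [mul_assoc, mul_assoc, mul_assoc]
  congr 4
  field_simp

end Bridge

/-- Gaussian lower bound for the single-jump law of the bridge (estimate (3.107)): on balls
of radius `K f''(c_ε)^{-1/2}` around `c_ε e₁`, `c_ε := g(‖x‖/(ε r_ε T))`, the jump law
dominates `(1-δ)` times the normal law with mean `c_ε e₁` and covariance
`f''(c_ε)⁻¹ diag(1, α-1, …, α-1)`. -/
theorem stmt15 {n : ℕ} [NeZero n] {α : ℝ} (hα : 1 < α) {f : ℝ → ℝ}
    (hf : SmoothRegVary α f)
    (hconv : ConvexOn ℝ (Set.Ici (0 : ℝ)) f) (hmono : MonotoneOn f (Set.Ici (0 : ℝ)))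
    (hnorm : ∫ z : EuclideanSpace ℝ (Fin n), Real.exp (-f ‖z‖) = 1)
    (g : ℝ → ℝ) (Λ₀ : ℝ) (hgtop : Filter.Tendsto g Filter.atTop Filter.atTop)
    (hg : ∀ Λ : ℝ, Λ₀ < Λ →
      g Λ * deriv f (g Λ) - f (g Λ) + Real.log (g Λ)
          - (n : ℝ) / 2 * Real.log (deriv (deriv f) (g Λ))
        = Real.log ((2 * π) ^ (-(n : ℝ) / 2) * (α - 1) ^ (-((n : ℝ) - 1) / 2) * Λ))
    (T : ℝ) (hT : 0 < T) (x : EuclideanSpace ℝ (Fin n)) (hx : x ≠ 0)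
    (hxe₁ : x = ‖x‖ • EuclideanSpace.single (0 : Fin n) (1 : ℝ))
    (r : ℝ → ℝ) (hrpos : ∀ ε : ℝ, 0 < ε → 0 < r ε)
    (ρ γ : ℝ) (hργ : ρ < γ) (hγ1 : γ < 1)
    (hscale : ∀ᶠ ε in 𝓝[>] (0 : ℝ),
      (‖x‖ / ε) ^ ρ ≤ r ε * T ∧ r ε * T ≤ (‖x‖ / ε) ^ γ) :
    ∀ δ ∈ Set.Ioo (0 : ℝ) 1, ∀ K > (0 : ℝ), ∃ ε₀ > (0 : ℝ), ∀ ε : ℝ, 0 < ε → ε < ε₀ →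
      ∀ A : Set (EuclideanSpace ℝ (Fin n)), MeasurableSet A →
        A ⊆ {y : EuclideanSpace ℝ (Fin n) |
            ‖y - g (‖x‖ / (ε * r ε * T)) • EuclideanSpace.single (0 : Fin n) (1 : ℝ)‖
              ≤ K * deriv (deriv f) (g (‖x‖ / (ε * r ε * T))) ^ (-(1 : ℝ) / 2)} →
        (1 - δ) * ∫ y in A,
            (deriv (deriv f) (g (‖x‖ / (ε * r ε * T))) / (2 * π)) ^ ((n : ℝ) / 2) *
              (α - 1) ^ (-((n : ℝ) - 1) / 2) *
              Real.exp (-(deriv (deriv f) (g (‖x‖ / (ε * r ε * T))) / 2) *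
                ((y 0 - g (‖x‖ / (ε * r ε * T))) ^ 2 +
                  (α - 1)⁻¹ * ∑ i ∈ Finset.univ.erase (0 : Fin n), y i ^ 2))
          ≤ singleJumpLaw n f (r ε * T) (ε⁻¹ • x) A := by
  intro δ hδ K hK
  have hβ : 0 < α - 1 := by linarith
  have hx0 : 0 < ‖x‖ := norm_pos_iff.2 hx
  have hid : Tendsto (fun ε : ℝ => ε) (𝓝[>] 0) (𝓝[>] 0) := tendsto_id
  have hX : Tendsto (fun ε => ‖x‖ / ε) (𝓝[>] (0 : ℝ)) atTop := by
    simp only [div_eq_mul_inv]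
    exact hid.inv_tendsto_nhdsGT_zero.const_mul_atTop hx0
  have ht : ∀ᶠ ε in 𝓝[>] (0 : ℝ), 0 < r ε * T := by
    filter_upwards [eventually_mem_nhdsWithin] with ε hε
    exact mul_pos (hrpos ε hε) hT
  obtain ⟨hc, hN, haN, ha, heq⟩ := hf.scale_asymptotics hα n (gaussConst_pos (n := n) hβ) hgtop hg hργ
    hγ1 hX ht hscale
  have hG := (hf.tendstoGauss (n := n) hα hconv hmono).comp hc
  have hwin := hG.exists_window (e := EuclideanSpace.single (0 : Fin n) (1 : ℝ)) hN ha haN (by simp)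
    (δ := δ / 2) (by linarith [hδ.1]) (by linarith [hδ.2]) K
  have hall := (hwin.and heq).and ((hc.eventually (hf.eventually_deriv_pos hα)).and
    ((hc.eventually_gt_atTop 0).and hG.dens))
  obtain ⟨ε₀, hε₀, hsub⟩ := mem_nhdsGT_iff_exists_Ioo_subset.1 hall
  refine ⟨ε₀, hε₀, fun ε hε hεlt A hA hAsub => ?_⟩
  obtain ⟨⟨⟨hs, hZ, Ω, hΩ, hjump⟩, ht⟩, hd, hc0, hdens⟩ := hsub ⟨hε, hεlt⟩
  have hz : ε⁻¹ • x = (‖x‖ / ε) • EuclideanSpace.single (0 : Fin n) (1 : ℝ) := by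
    conv_lhs => rw [hxe₁]
    rw [smul_smul, inv_mul_eq_div]
  have harg : ‖x‖ / (ε * r ε * T) = ‖x‖ / ε / (r ε * T) := by rw [mul_assoc, div_div]
  rw [hz, harg]
  rw [harg] at hAsub
  set X := ‖x‖ / ε
  set c := g (X / (r ε * T))
  set s := localScale f c with hs_def
  have hs0 : 0 < s := localScale_pos hd.2
  set e : EuclideanSpace ℝ (Fin n) := EuclideanSpace.single (0 : Fin n) (1 : ℝ)
  set W := jumpWeight (tiltDens (α - 1) f c) (X / c) (c / s) e
  have hW0 : ∀ m, 0 ≤ W m := fun m =>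
    jumpWeight_nonneg hdens.nonneg (div_nonneg (by positivity) hc0.le) _ _ _
  set Z := ∑' m, W m
  have hq : ∀ m, jumpCountProb n f (r ε * T) (X • e) (m + 1) = W m / Z :=
    jumpCountProb_eq hβ hc0 hs0 ht
  set p : EuclideanSpace ℝ (Fin n) → ℝ := fun w => exp (-f ‖w‖)
  have hp : IsDensity p := by
    refine ⟨(measurable_comp_norm hmono).neg.exp, fun w => (exp_pos _).le, ?_, exp (-f 0), fun w => ?_⟩
    · by_contra hni
      rw [integral_undef hni] at hnorm
      exact zero_ne_one hnorm
    · exact exp_le_exp.2 (neg_le_neg (hmono self_mem_Ici (mem_Ici.2 (norm_nonneg w)) (norm_nonneg w)))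
  set σ : ℕ → EuclideanSpace ℝ (Fin n) → ℝ := fun m w => singleJumpDensity n f (X • e) (m + 2) w
  have hσ : ∀ m w, σ m w = (convPow n p (m + 1) (X • e))⁻¹ * (convPow n p m (X • e - w) * p w) := by
    intro m w
    simp only [σ, singleJumpDensity]
    rw [Nat.add_sub_cancel, show m + 2 - 1 = m + 1 from rfl]
    simp only [p]
    ring
  have hσ0 : ∀ m w, 0 ≤ σ m w := fun m w => by
    rw [hσ]
    exact mul_nonneg (inv_nonneg.2 (convPow_nonneg hp.nonneg _ _))
      (mul_nonneg (convPow_nonneg hp.nonneg _ _) (hp.nonneg _))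
  have hσi : ∀ m, Integrable (σ m) := fun m =>
    ((hp.convPow_integrand m (X • e)).const_mul _).congr (Eventually.of_forall fun w => (hσ m w).symm)
  have hσ1 : ∀ m, ∫ w in A, σ m w ≤ 1 := by
    intro m
    refine (setIntegral_le_integral (hσi m) (Eventually.of_forall (hσ0 m))).trans ?_
    rw [integral_congr_ae (Eventually.of_forall (hσ m)), integral_const_mul]
    exact inv_mul_le_one
  set G : EuclideanSpace ℝ (Fin n) → ℝ := fun y =>
    (deriv (deriv f) c / (2 * π)) ^ ((n : ℝ) / 2) * (α - 1) ^ (-((n : ℝ) - 1) / 2) *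
      Real.exp (-(deriv (deriv f) c / 2) * ((y 0 - c) ^ 2 +
        (α - 1)⁻¹ * ∑ i ∈ Finset.univ.erase (0 : Fin n), y i ^ 2))
  have hG0 : ∀ y, 0 ≤ G y := fun y => by
    have := hd.2
    simp only [G]; positivity
  have hJ0 : 0 ≤ ∫ y in A, G y := integral_nonneg hG0
  have hlow : ∀ m ∈ Ω, (1 - δ / 2) * ∫ y in A, G y ≤ ∫ w in A, σ m w := by
    intro m hm
    rw [← integral_const_mul]
    refine integral_mono_of_nonneg (Eventually.of_forall fun y =>
      mul_nonneg (by linarith [hδ.2]) (hG0 y)) (hσi m).restrict ?_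
    refine (ae_restrict_iff' hA).2 (Eventually.of_forall fun y hy => ?_)
    obtain ⟨u, rfl⟩ : ∃ u, y = c • e + s • u :=
      ⟨s⁻¹ • (y - c • e), by rw [smul_inv_smul₀ hs0.ne']; abel⟩
    have hu : ‖u‖ ≤ K := by
      have h : ‖c • e + s • u - c • e‖ ≤ K * s := hAsub hy
      rw [add_sub_cancel_left, norm_smul, norm_of_nonneg hs0.le, mul_comm] at h
      exact le_of_mul_le_mul_right h hs0
    obtain ⟨hv0, hv⟩ := hjump m hm _ rfl u hu
    have h1 : G (c • e + s • u) = (s ^ n)⁻¹ * gaussDens (α - 1) u := gaussDens_local_eq hd.2 u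
    have h2 := singleJumpDensity_eq (X := X) hβ hc0 hs0 m u _ rfl
    change (1 - δ / 2) * G (c • e + s • u) ≤ singleJumpDensity n f (X • e) (m + 2) (c • e + s • u)
    rw [h1, h2, mul_left_comm]
    refine mul_le_mul_of_nonneg_left ?_ (by positivity)
    rw [le_inv_mul_iff₀ hv0]
    linarith
  have hsum1 : Summable fun m => W (m + 1) / Z := ((summable_nat_add_iff 1).2 hs).div_const Z
  have hI0 : ∀ m, 0 ≤ ∫ w in A, σ m w := fun m => integral_nonneg (hσ0 m)
  have hsum2 : Summable fun m => W (m + 1) / Z * ∫ w in A, σ m w :=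
    Summable.of_nonneg_of_le (fun m => mul_nonneg (div_nonneg (hW0 _) hZ.le) (hI0 m))
      (fun m => mul_le_of_le_one_right (div_nonneg (hW0 _) hZ.le) (hσ1 m)) hsum1
  have hΩs : Summable (Ω.indicator fun m => W (m + 1)) := ((summable_nat_add_iff 1).2 hs).indicator Ω
  have hstep : ∑' m, Ω.indicator (fun m => W (m + 1)) m * (Z⁻¹ * ((1 - δ / 2) * ∫ y in A, G y)) ≤
      ∑' m, W (m + 1) / Z * ∫ w in A, σ m w := by
    refine (hΩs.mul_right _).tsum_le_tsum (fun m => ?_) hsum2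
    by_cases hm : m ∈ Ω
    · rw [indicator_of_mem hm, ← mul_assoc, ← div_eq_mul_inv]
      exact mul_le_mul_of_nonneg_left (hlow m hm) (div_nonneg (hW0 _) hZ.le)
    · rw [indicator_of_notMem hm, zero_mul]
      exact mul_nonneg (div_nonneg (hW0 _) hZ.le) (hI0 m)
  rw [tsum_mul_right] at hstep
  have hfirst : 0 ≤ jumpCountProb n f (r ε * T) (X • e) 1 * indicator A (fun _ => (1 : ℝ)) (X • e) := by
    refine mul_nonneg ?_ (indicator_nonneg (fun _ _ => zero_le_one) _)
    rw [hq 0]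
    exact div_nonneg (hW0 0) hZ.le
  have hlaw : singleJumpLaw n f (r ε * T) (X • e) A =
      jumpCountProb n f (r ε * T) (X • e) 1 * indicator A (fun _ => (1 : ℝ)) (X • e) +
        ∑' m, W (m + 1) / Z * ∫ w in A, σ m w := by
    rw [singleJumpLaw]
    congr 1
    exact tsum_congr fun m => by rw [← hq (m + 1)]
  rw [hlaw]
  refine le_trans ?_ (le_add_of_nonneg_left hfirst)
  refine le_trans ?_ hstep
  calc (1 - δ) * ∫ y in A, G y
      ≤ (1 - δ / 2) * ((1 - δ / 2) * ∫ y in A, G y) := by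
        rw [← mul_assoc]
        refine mul_le_mul_of_nonneg_right ?_ hJ0
        nlinarith [sq_nonneg δ]
    _ = (1 - δ / 2) * Z * (Z⁻¹ * ((1 - δ / 2) * ∫ y in A, G y)) := by field_simp
    _ ≤ _ := mul_le_mul_of_nonneg_right hΩ
        (mul_nonneg (inv_nonneg.2 hZ.le) (mul_nonneg (by linarith [hδ.2]) hJ0))
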